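/- arXiv:1309.0938 — 5 statements merged into one kernel-verified Lean document; each statement's English description precedes it below -/
import Mathlib

section
/- Let 0 = r_0 < r_1 < ... < r_m be real numbers, Λ_m = (r_0,...,r_m), 0 < a < 1, and let (B_0,...,B_m) be the Chebyshev–Bernstein basis of E(Λ_m) on [a,1] (functions in E(Λ_m) with ∑_i B_i ≡ 1 on [a,1], B_i^{(j)}(a) = 0 for 0 ≤ j ≤ i−1, B_i^{(j)}(1) = 0 for 0 ≤ j ≤ m−i−1). Let k ∈ {1,...,m} and let c_0,...,c_m and d_0,...,d_m be the real coefficients with t^{r_1} = ∑_{i=0}^m B_i(t) c_i and t^{r_k} = ∑_{i=0}^m B_i(t) d_i for all t ∈ [a,1]. Then for every i ∈ {0,...,m}: c_i ≥ 0 and (c_i)^{r_k/r_1} ≥ d_i. -/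
open Filter Topology

/-- `f` belongs to the Müntz space `E(Λ_n) = span(t^{r_0}, t^{r_1}, ..., t^{r_n})`
(as a function of `t > 0`, where `t ^ r` is the real power). -/
def InMuntz (r : ℕ → ℝ) (n : ℕ) (f : ℝ → ℝ) : Prop :=
  ∃ c : ℕ → ℝ, ∀ t : ℝ, 0 < t → f t = ∑ j ∈ Finset.range (n + 1), c j * t ^ r j

/-- `B 0, ..., B n` is the Chebyshev–Bernstein basis of the Müntz space `E(Λ_n)` on `[a,b]`:
the functions belong to `E(Λ_n)`, sum to `1` on `[a,b]`, `B k` has a zero of order `k` at `a`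
(derivatives of order `j ≤ k - 1` vanish) and a zero of order `n - k` at `b`
(derivatives of order `j ≤ n - k - 1` vanish). -/
def IsChebBernstein (r : ℕ → ℝ) (n : ℕ) (a b : ℝ) (B : ℕ → ℝ → ℝ) : Prop :=
  (∀ k ≤ n, InMuntz r n (B k)) ∧
  (∀ t ∈ Set.Icc a b, ∑ k ∈ Finset.range (n + 1), B k t = 1) ∧
  (∀ k ≤ n, ∀ j < k, iteratedDeriv j (B k) a = 0) ∧
  (∀ k ≤ n, ∀ j < n - k, iteratedDeriv j (B k) b = 0)

/-- The exponential sum `x ↦ ∑ j ∈ J, f j * exp (s j * x)`. -/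
noncomputable def expSum (J : Finset ℕ) (s f : ℕ → ℝ) (x : ℝ) : ℝ :=
  ∑ j ∈ J, f j * Real.exp (s j * x)

/-- The derivatives of order `< p` of `expSum J s f` vanish at `x`. -/
def ExpSumVanish (J : Finset ℕ) (s f : ℕ → ℝ) (p : ℕ) (x : ℝ) : Prop :=
  ∀ i < p, expSum J s (fun j => f j * s j ^ i) x = 0

lemma hasDerivAt_expSum (J : Finset ℕ) (s f : ℕ → ℝ) (x : ℝ) :
    HasDerivAt (expSum J s f) (expSum J s (fun j => f j * s j) x) x := by
  unfold expSum
  refine HasDerivAt.fun_sum fun j _ => ?_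
  have h := (((hasDerivAt_id x).const_mul (s j)).exp).const_mul (f j)
  refine h.congr_deriv ?_
  simp only [id, mul_one]
  ring

lemma continuous_expSum (J : Finset ℕ) (s f : ℕ → ℝ) : Continuous (expSum J s f) :=
  continuous_iff_continuousAt.2 fun x => (hasDerivAt_expSum J s f x).continuousAt

lemma expSum_neg (J : Finset ℕ) (s f : ℕ → ℝ) (x : ℝ) :
    expSum J s (fun j => -f j) x = -expSum J s f x := by
  simp [expSum]

lemma expSum_sub (J : Finset ℕ) (s f g : ℕ → ℝ) (x : ℝ) :
    expSum J s (fun j => f j - g j) x = expSum J s f x - expSum J s g x := by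
  simp [expSum, sub_mul, Finset.sum_sub_distrib]

lemma expSum_sum (I J : Finset ℕ) (s e : ℕ → ℝ) (b : ℕ → ℕ → ℝ) (x : ℝ) :
    expSum J s (fun j => ∑ i ∈ I, e i * b i j) x = ∑ i ∈ I, e i * expSum J s (b i) x := by
  simp only [expSum, Finset.sum_mul, Finset.mul_sum]
  rw [Finset.sum_comm]
  simp only [mul_assoc]

lemma expSum_congr {J : Finset ℕ} {s f g : ℕ → ℝ} (h : ∀ j ∈ J, f j = g j) (x : ℝ) :
    expSum J s f x = expSum J s g x :=
  Finset.sum_congr rfl fun j hj => by rw [h j hj]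

lemma expSum_erase {J : Finset ℕ} {l : ℕ} (hl : l ∈ J) (s f : ℕ → ℝ) (i : ℕ) (x : ℝ) :
    expSum (J.erase l) s (fun j => f j * (s j - s l) * s j ^ i) x =
      expSum J s (fun j => f j * s j ^ (i + 1)) x - s l * expSum J s (fun j => f j * s j ^ i) x := by
  unfold expSum
  rw [Finset.mul_sum, ← Finset.sum_sub_distrib, ← Finset.add_sum_erase J _ hl]
  have : f l * s l ^ (i + 1) * Real.exp (s l * x)
      - s l * (f l * s l ^ i * Real.exp (s l * x)) = 0 := by ring
  rw [this, zero_add]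
  refine Finset.sum_congr rfl fun j _ => ?_
  ring

lemma ExpSumVanish.erase {J : Finset ℕ} {l : ℕ} (hl : l ∈ J) {s f : ℕ → ℝ} {p : ℕ} {x : ℝ}
    (h : ExpSumVanish J s f (p + 1) x) :
    ExpSumVanish (J.erase l) s (fun j => f j * (s j - s l)) p x := by
  intro i hi
  rw [expSum_erase hl, h i (by omega), h (i + 1) (by omega)]
  ring

lemma ExpSumVanish.apply_eq_zero {J : Finset ℕ} {s f : ℕ → ℝ} {p : ℕ} {x : ℝ}
    (h : ExpSumVanish J s f p x) (hp : 0 < p) : expSum J s f x = 0 := by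
  simpa using h 0 hp

lemma ExpSumVanish.succ {J : Finset ℕ} {s f : ℕ → ℝ} {p : ℕ} {x : ℝ}
    (h : ExpSumVanish J s f p x) (hp : expSum J s (fun j => f j * s j ^ p) x = 0) :
    ExpSumVanish J s f (p + 1) x := by
  intro i hi
  rcases Nat.lt_succ_iff_lt_or_eq.1 hi with hi | rfl
  · exact h i hi
  · exact hp

lemma ExpSumVanish.mono {J : Finset ℕ} {s f : ℕ → ℝ} {p q : ℕ} {x : ℝ}
    (h : ExpSumVanish J s f p x) (hq : q ≤ p) : ExpSumVanish J s f q x :=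
  fun i hi => h i (hi.trans_le hq)

lemma ExpSumVanish.congr {J : Finset ℕ} {s f g : ℕ → ℝ} {p : ℕ} {x : ℝ}
    (h : ExpSumVanish J s f p x) (hfg : ∀ j ∈ J, f j = g j) : ExpSumVanish J s g p x := by
  intro i hi
  rw [← h i hi]
  exact expSum_congr (fun j hj => by rw [hfg j hj]) x

lemma ExpSumVanish.sum {I J : Finset ℕ} {s e : ℕ → ℝ} {b : ℕ → ℕ → ℝ} {p : ℕ} {x : ℝ}
    (h : ∀ i ∈ I, ExpSumVanish J s (b i) p x) :
    ExpSumVanish J s (fun j => ∑ i ∈ I, e i * b i j) p x := by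
  intro n hn
  have : expSum J s (fun j => (∑ i ∈ I, e i * b i j) * s j ^ n) x =
      expSum J s (fun j => ∑ i ∈ I, e i * (b i j * s j ^ n)) x :=
    expSum_congr (fun j _ => by simp only [Finset.sum_mul, mul_assoc]) x
  rw [this, expSum_sum I J s e (fun i j => b i j * s j ^ n)]
  exact Finset.sum_eq_zero fun i hi => by rw [h i hi n hn, mul_zero]

lemma hasDerivAt_exp_mul_expSum {J : Finset ℕ} {l : ℕ} (hl : l ∈ J) (s f : ℕ → ℝ) (x : ℝ) :
    HasDerivAt (fun y => Real.exp (-s l * y) * expSum J s f y)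
      (Real.exp (-s l * x) * expSum (J.erase l) s (fun j => f j * (s j - s l)) x) x := by
  have h1 := (((hasDerivAt_id x).const_mul (-s l)).exp).mul (hasDerivAt_expSum J s f x)
  refine h1.congr_deriv ?_
  have h2 := expSum_erase hl s f 0 x
  simp only [pow_zero, mul_one, zero_add, pow_one] at h2
  rw [h2]
  simp only [id, mul_one]
  ring

/-- The Rolle theorem for exponential sums. -/
lemma exists_expSum_erase_eq_zero {J : Finset ℕ} {l : ℕ} (hl : l ∈ J) {s f : ℕ → ℝ} {x y : ℝ}
    (hxy : x < y) (hx : expSum J s f x = 0) (hy : expSum J s f y = 0) :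
    ∃ z ∈ Set.Ioo x y, expSum (J.erase l) s (fun j => f j * (s j - s l)) z = 0 := by
  obtain ⟨z, hz, h⟩ := exists_hasDerivAt_eq_zero hxy
    (fun z _ => (hasDerivAt_exp_mul_expSum hl s f z).continuousAt.continuousWithinAt)
    (by simp only [hx, hy, mul_zero]) (fun z _ => hasDerivAt_exp_mul_expSum hl s f z)
  exact ⟨z, hz, (mul_eq_zero.1 h).resolve_left (Real.exp_ne_zero _)⟩

/-- An exponential sum with `n` distinct exponents and at least `n` zeros, counted with
multiplicity, is trivial. -/
theorem expSum_coeff_eq_zero (J : Finset ℕ) (s : ℕ → ℝ) (hs : Set.InjOn s J) (f : ℕ → ℝ)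
    (S : Finset ℝ) (ν : ℝ → ℕ) (h : ∀ x ∈ S, ExpSumVanish J s f (ν x) x)
    (hcard : J.card ≤ ∑ x ∈ S, ν x) : ∀ j ∈ J, f j = 0 := by
  classical
  induction hn : J.card generalizing J f S ν with
  | zero => simp [Finset.card_eq_zero.1 hn]
  | succ n ih =>
    obtain ⟨l, hl⟩ := Finset.card_pos.1 (by omega : 0 < J.card)
    set g : ℕ → ℝ := fun j => f j * (s j - s l) with hg
    set S' := S.filter (fun x => ν x ≠ 0) with hS'
    have hsum : ∑ x ∈ S', ν x = ∑ x ∈ S, ν x := Finset.sum_filter_ne_zero S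
    have hpos : ∀ x ∈ S', 0 < ν x := fun x hx => Nat.pos_of_ne_zero (Finset.mem_filter.1 hx).2
    have hS : ∀ x ∈ S', ExpSumVanish J s f (ν x) x := fun x hx => h x (Finset.mem_filter.1 hx).1
    have hroot : ∀ q : ℝ × ℝ, q.1 ∈ S' → q.2 ∈ S' → q.1 < q.2 →
        ∃ z ∈ Set.Ioo q.1 q.2, expSum (J.erase l) s g z = 0 := fun q h1 h2 h12 =>
      exists_expSum_erase_eq_zero hl h12 ((hS _ h1).apply_eq_zero (hpos _ h1))
        ((hS _ h2).apply_eq_zero (hpos _ h2))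
    choose! z hz hz0 using hroot
    set T := (((S' ×ˢ S').filter (fun q => q.1 < q.2)).image z) \ S' with hT
    have hTroot : ∀ x ∈ T, expSum (J.erase l) s g x = 0 := by
      intro x hx
      obtain ⟨q, hq, rfl⟩ := Finset.mem_image.1 (Finset.mem_sdiff.1 hx).1
      obtain ⟨hq1, hq2⟩ := Finset.mem_filter.1 hq
      exact hz0 q (Finset.mem_product.1 hq1).1 (Finset.mem_product.1 hq1).2 hq2
    have hTS : ∀ x ∈ T, x ∉ S' := fun x hx => (Finset.mem_sdiff.1 hx).2
    have hTcard : S'.card ≤ T.card + 1 := by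
      refine Finset.card_le_sdiff_of_interleaved fun x hx y hy hxy _ => ?_
      have := hz (x, y) hx hy hxy
      exact ⟨z (x, y), Finset.mem_image_of_mem _
        (Finset.mem_filter.2 ⟨Finset.mem_product.2 ⟨hx, hy⟩, hxy⟩), this.1, this.2⟩
    have hdisj : Disjoint S' T := Finset.disjoint_right.2 hTS
    have hcard' : (J.erase l).card = n := by rw [Finset.card_erase_of_mem hl, hn]; rfl
    have key : ∀ j ∈ J.erase l, g j = 0 := by
      refine ih (J.erase l) (hs.mono (by exact_mod_cast Finset.erase_subset l J)) g (S' ∪ T)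
        (fun x => if x ∈ S' then ν x - 1 else 1) ?_ ?_ hcard'
      · intro x hx
        by_cases hxS : x ∈ S'
        · simp only [hxS, if_true]
          refine ExpSumVanish.erase hl ?_
          rw [Nat.sub_add_cancel (hpos x hxS)]
          exact hS x hxS
        · simp only [hxS, if_false]
          intro i hi
          obtain rfl : i = 0 := by omega
          simpa using hTroot x ((Finset.mem_union.1 hx).resolve_left hxS)
      · rw [Finset.sum_union hdisj]
        have h1 : ∑ x ∈ S', (if x ∈ S' then ν x - 1 else 1) + S'.card = ∑ x ∈ S', ν x := by
          rw [Finset.card_eq_sum_ones, ← Finset.sum_add_distrib]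
          refine Finset.sum_congr rfl fun x hx => ?_
          have := hpos x hx
          simp only [hx, if_true]
          omega
        have h2 : ∑ x ∈ T, (if x ∈ S' then ν x - 1 else 1) = T.card := by
          rw [Finset.card_eq_sum_ones]
          exact Finset.sum_congr rfl fun x hx => by simp [hTS x hx]
        omega
    have hf : ∀ j ∈ J.erase l, f j = 0 := by
      intro j hj
      refine (mul_eq_zero.1 (key j hj)).resolve_right fun h0 => Finset.ne_of_mem_erase hj ?_
      exact hs (Finset.mem_of_mem_erase hj) hl (sub_eq_zero.1 h0)
    obtain ⟨x, hx⟩ : S'.Nonempty := by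
      rw [Finset.nonempty_iff_ne_empty]
      intro h0
      rw [h0, Finset.sum_empty] at hsum
      omega
    have h0 := (hS x hx).apply_eq_zero (hpos x hx)
    rw [expSum, ← Finset.add_sum_erase J _ hl,
      Finset.sum_eq_zero (s := J.erase l) (fun j hj => by rw [hf j hj, zero_mul]), add_zero] at h0
    intro j hj
    by_cases hjl : j = l
    · rw [hjl]
      exact (mul_eq_zero.1 h0).resolve_right (Real.exp_ne_zero _)
    · exact hf j (Finset.mem_erase.2 ⟨hjl, hj⟩)

lemma expSum_coeff_eq_zero_of_two {J : Finset ℕ} {s : ℕ → ℝ} (hs : Set.InjOn s J) {f : ℕ → ℝ}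
    {α β : ℝ} (hαβ : α < β) {p q : ℕ} (hp : ExpSumVanish J s f p α) (hq : ExpSumVanish J s f q β)
    (hcard : J.card ≤ p + q) : ∀ j ∈ J, f j = 0 := by
  refine expSum_coeff_eq_zero J s hs f {α, β} (fun x => if x = α then p else q) ?_ ?_
  · intro x hx
    rcases Finset.mem_insert.1 hx with rfl | hx
    · simpa using hp
    · obtain rfl := Finset.mem_singleton.1 hx
      simpa [hαβ.ne'] using hq
  · rw [Finset.sum_pair hαβ.ne]
    simpa [hαβ.ne'] using hcard

lemma expSum_coeff_eq_zero_of_three {J : Finset ℕ} {s : ℕ → ℝ} (hs : Set.InjOn s J) {f : ℕ → ℝ}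
    {α β w : ℝ} (hα : α < w) (hβ : w < β) {p q : ℕ} (hp : ExpSumVanish J s f p α)
    (hq : ExpSumVanish J s f q β) (hw : expSum J s f w = 0)
    (hcard : J.card ≤ p + q + 1) : ∀ j ∈ J, f j = 0 := by
  refine expSum_coeff_eq_zero J s hs f {α, β, w}
    (fun x => if x = α then p else if x = β then q else 1) ?_ ?_
  · intro x hx
    simp only [Finset.mem_insert, Finset.mem_singleton] at hx
    rcases hx with rfl | rfl | rfl
    · simpa using hp
    · simpa [(hα.trans hβ).ne'] using hq
    · simp only [hα.ne', hβ.ne, if_false]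
      intro i hi
      obtain rfl : i = 0 := by omega
      simpa using hw
  · rw [Finset.sum_insert (by simp [(hα.trans hβ).ne, hα.ne]), Finset.sum_pair hβ.ne']
    simp only [hα.ne', hβ.ne, (hα.trans hβ).ne', if_true, if_false]
    omega

/-- If the first nonvanishing derivative at `x` is positive, then so is the exponential sum on some
right neighbourhood of `x`. -/
lemma exists_expSum_pos {J : Finset ℕ} {s f : ℕ → ℝ} {p : ℕ} {x : ℝ}
    (h : ExpSumVanish J s f p x) (hp : 0 < expSum J s (fun j => f j * s j ^ p) x) :
    ∃ δ > 0, ∀ z ∈ Set.Ioo x (x + δ), 0 < expSum J s f z := by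
  induction p generalizing f with
  | zero =>
    simp only [pow_zero, mul_one] at hp
    obtain ⟨δ, hδ, H⟩ := Metric.eventually_nhds_iff.1
      ((continuous_expSum J s f).continuousAt.eventually (lt_mem_nhds hp))
    refine ⟨δ, hδ, fun z hz => H ?_⟩
    rw [Real.dist_eq, abs_lt]
    constructor <;> linarith [hz.1, hz.2]
  | succ p ih =>
    obtain ⟨δ, hδ, H⟩ := ih (f := fun j => f j * s j)
      (fun i hi => by
        have := h (i + 1) (by omega)
        simpa only [pow_succ', mul_assoc] using this)
      (by simpa only [pow_succ', mul_assoc] using hp)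
    refine ⟨δ, hδ, fun z hz => ?_⟩
    obtain ⟨w, hw, hw'⟩ := exists_hasDerivAt_eq_slope (expSum J s f)
      (fun y => expSum J s (fun j => f j * s j) y) hz.1 (continuous_expSum J s f).continuousOn
      (fun y _ => hasDerivAt_expSum J s f y)
    have h1 := H w ⟨hw.1, hw.2.trans hz.2⟩
    rw [hw', h.apply_eq_zero (Nat.succ_pos p), sub_zero] at h1
    exact (div_pos_iff_of_pos_right (sub_pos.2 hz.1)).1 h1

/-- If `F` vanishes to order `p` at `α` and agrees with `η * exp (s l * x)` to order `p'` at `β`,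
where `p + p'` is the number of exponents, then the `p`-th derivative of `F` at `α` is positive. -/
lemma expSum_pos_of_interpolation {J : Finset ℕ} {s : ℕ → ℝ} (hs : Set.InjOn s J) {l : ℕ}
    (hl : l ∈ J) {f h : ℕ → ℝ} (hh : ∀ j ∈ J, j ≠ l → h j = 0) (hη : 0 < h l)
    {α β : ℝ} (hαβ : α < β) {p p' : ℕ} (hp' : 0 < p') (hcard : p + p' = J.card)
    (hα : ExpSumVanish J s f p α) (hβ : ExpSumVanish J s (fun j => h j - f j) p' β) :
    0 < expSum J s (fun j => f j * s j ^ p) α := by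
  have hsum : ∀ x, expSum J s h x = h l * Real.exp (s l * x) := fun x =>
    Finset.sum_eq_single_of_mem l hl fun j hj hjl => by rw [hh j hj hjl, zero_mul]
  obtain ⟨q', rfl⟩ := Nat.exists_eq_succ_of_ne_zero hp'.ne'
  rcases p with _ | q
  · have h0 := expSum_coeff_eq_zero_of_two hs hαβ
      (fun i hi => absurd hi (Nat.not_lt_zero i)) hβ hcard.ge
    simp only [pow_zero, mul_one]
    rw [show expSum J s (fun j => f j) α = expSum J s h α from
      expSum_congr (fun j hj => by linarith [h0 j hj]) α, hsum]
    positivity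
  · set g : ℕ → ℝ := fun j => f j * (s j - s l) with hg
    have hgα : ExpSumVanish (J.erase l) s g q α := hα.erase hl
    have hgβ : ExpSumVanish (J.erase l) s (fun j => -g j) q' β := by
      refine (hβ.erase hl).congr fun j hj => ?_
      simp only [hg, hh j (Finset.mem_of_mem_erase hj) (Finset.ne_of_mem_erase hj)]
      ring
    have hgα' : ExpSumVanish (J.erase l) s (fun j => -g j) q α := fun i hi => by
      simpa [hgα i hi] using expSum_neg (J.erase l) s (fun j => g j * s j ^ i) α
    have hs' : Set.InjOn s (J.erase l) := hs.mono (by exact_mod_cast Finset.erase_subset l J)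
    have hc' : (J.erase l).card + 1 = J.card := Finset.card_erase_add_one hl
    obtain ⟨ξ, hξ, hξ'⟩ := exists_hasDerivAt_eq_slope
      (fun y => Real.exp (-s l * y) * expSum J s f y) _ hαβ
      (fun z _ => (hasDerivAt_exp_mul_expSum hl s f z).continuousAt.continuousWithinAt)
      (fun z _ => hasDerivAt_exp_mul_expSum hl s f z)
    have hgξ : 0 < expSum (J.erase l) s g ξ := by
      have h1 := hα.apply_eq_zero (Nat.succ_pos q)
      have h2 := hβ.apply_eq_zero hp'
      rw [expSum_sub, hsum] at h2
      have h3 : 0 < expSum J s f β := by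
        have : 0 < h l * Real.exp (s l * β) := by positivity
        linarith
      rw [h1, mul_zero, sub_zero] at hξ'
      have h4 : 0 < Real.exp (-s l * ξ) * expSum (J.erase l) s g ξ := by
        rw [hξ']
        exact div_pos (mul_pos (Real.exp_pos _) h3) (sub_pos.2 hαβ)
      exact pos_of_mul_pos_right h4 (Real.exp_pos _).le
    have hne : ¬ ∀ j ∈ J.erase l, -g j = 0 := fun h0 => by
      have : expSum (J.erase l) s g ξ = 0 :=
        Finset.sum_eq_zero fun j hj => by rw [neg_eq_zero.1 (h0 j hj), zero_mul]
      linarith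
    have herase := expSum_erase hl s f q α
    rw [hα q (by omega), mul_zero, sub_zero] at herase
    rw [← herase]
    by_contra! hle
    have hle' : 0 ≤ expSum (J.erase l) s (fun j => -g j * s j ^ q) α := by
      have := expSum_neg (J.erase l) s (fun j => g j * s j ^ q) α
      simp only [neg_mul]
      linarith
    rcases hle'.eq_or_lt with h0 | hlt
    · exact hne (expSum_coeff_eq_zero_of_two hs' hαβ (hgα'.succ h0.symm) hgβ (by omega))
    · obtain ⟨δ, hδ, H⟩ := exists_expSum_pos hgα' hlt
      obtain ⟨z, hz1, hz2⟩ := exists_between (lt_min (lt_add_of_pos_right α hδ) hξ.1)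
      have hz := H z ⟨hz1, hz2.trans_le (min_le_left _ _)⟩
      have hzξ : z < ξ := hz2.trans_le (min_le_right _ _)
      obtain ⟨w, hw, hw0⟩ := intermediate_value_Icc' hzξ.le
        (continuous_expSum (J.erase l) s (fun j => -g j)).continuousOn
        (show (0 : ℝ) ∈ Set.Icc _ _ from ⟨by rw [expSum_neg]; linarith, hz.le⟩)
      exact hne (expSum_coeff_eq_zero_of_three hs' (hz1.trans_le hw.1) (hw.2.trans_lt hξ.2)
        hgα' hgβ hw0 (by omega))

lemma expSum_pos_of_interpolation_two {J : Finset ℕ} {s : ℕ → ℝ} (hs : Set.InjOn s J) {l₀ l : ℕ}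
    (hl₀ : l₀ ∈ J) (hl : l ∈ J) (hne : l ≠ l₀) {f h : ℕ → ℝ}
    (hh : ∀ j ∈ J, j ≠ l → j ≠ l₀ → h j = 0) (hη : 0 < h l * (s l - s l₀))
    {α β : ℝ} (hαβ : α < β) {p p' : ℕ} (hp' : 0 < p') (hcard : p + p' + 1 = J.card)
    (hα : ExpSumVanish J s f (p + 1) α)
    (hβ : ExpSumVanish J s (fun j => h j - f j) (p' + 1) β) :
    0 < expSum J s (fun j => f j * s j ^ (p + 1)) α := by
  have hc' : (J.erase l₀).card + 1 = J.card := Finset.card_erase_add_one hl₀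
  have := expSum_pos_of_interpolation (J := J.erase l₀) (s := s)
    (f := fun j => f j * (s j - s l₀)) (h := fun j => h j * (s j - s l₀))
    (hs.mono (by exact_mod_cast Finset.erase_subset l₀ J)) (Finset.mem_erase.2 ⟨hne, hl⟩)
    (fun j hj hjl => by
      rw [hh j (Finset.mem_of_mem_erase hj) hjl (Finset.ne_of_mem_erase hj), zero_mul])
    hη hαβ hp' (by omega) (hα.erase hl₀)
    ((hβ.erase hl₀).congr fun j _ => by ring)
  rwa [expSum_erase hl₀, hα p (by omega), mul_zero, sub_zero] at this

lemma expSum_pos_of_interpolation_three {J : Finset ℕ} {s : ℕ → ℝ} (hs : Set.InjOn s J)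
    {l₀ l₁ l : ℕ} (hl₀ : l₀ ∈ J) (hl₁ : l₁ ∈ J) (hl : l ∈ J) (h01 : l₁ ≠ l₀) (hne₀ : l ≠ l₀)
    (hne₁ : l ≠ l₁) {f h : ℕ → ℝ} (hh : ∀ j ∈ J, j ≠ l → j ≠ l₁ → j ≠ l₀ → h j = 0)
    (hη : 0 < h l * (s l - s l₀) * (s l - s l₁))
    {α β : ℝ} (hαβ : α < β) {p p' : ℕ} (hp' : 0 < p') (hcard : p + p' + 2 = J.card)
    (hα : ExpSumVanish J s f (p + 2) α)
    (hβ : ExpSumVanish J s (fun j => h j - f j) (p' + 2) β) :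
    0 < expSum J s (fun j => f j * s j ^ (p + 2)) α := by
  have hc' : (J.erase l₀).card + 1 = J.card := Finset.card_erase_add_one hl₀
  have := expSum_pos_of_interpolation_two (J := J.erase l₀) (s := s)
    (f := fun j => f j * (s j - s l₀)) (h := fun j => h j * (s j - s l₀))
    (hs.mono (by exact_mod_cast Finset.erase_subset l₀ J)) (Finset.mem_erase.2 ⟨h01, hl₁⟩)
    (Finset.mem_erase.2 ⟨hne₀, hl⟩) hne₁
    (fun j hj hjl hjl₁ => by
      rw [hh j (Finset.mem_of_mem_erase hj) hjl hjl₁ (Finset.ne_of_mem_erase hj), zero_mul])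
    hη hαβ hp' (by omega) (hα.erase hl₀)
    ((hβ.erase hl₀).congr fun j _ => by ring)
  rwa [expSum_erase hl₀, hα (p + 1) (by omega), mul_zero, sub_zero] at this

lemma iteratedDeriv_sum_rpow {J : Finset ℕ} {s c : ℕ → ℝ} {f : ℝ → ℝ}
    (hf : ∀ t : ℝ, 0 < t → f t = ∑ j ∈ J, c j * t ^ s j) (i : ℕ) :
    ∀ t : ℝ, 0 < t → iteratedDeriv i f t =
      ∑ j ∈ J, c j * (descPochhammer ℝ i).eval (s j) * t ^ (s j - i) := by
  induction i with
  | zero => intro t ht; simpa using hf t ht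
  | succ i ih =>
    intro t ht
    rw [iteratedDeriv_succ]
    have h1 : iteratedDeriv i f =ᶠ[𝓝 t]
        fun t => ∑ j ∈ J, c j * (descPochhammer ℝ i).eval (s j) * t ^ (s j - i) :=
      Filter.eventually_of_mem (Ioi_mem_nhds ht) fun u hu => ih u hu
    rw [h1.deriv_eq]
    refine HasDerivAt.deriv ?_
    refine HasDerivAt.fun_sum fun j _ => ?_
    refine ((Real.hasDerivAt_rpow_const (p := s j - i) (Or.inl ht.ne')).const_mul
      (c j * (descPochhammer ℝ i).eval (s j))).congr_deriv ?_
    rw [descPochhammer_succ_eval, Nat.cast_succ, sub_sub]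
    ring

lemma rpow_eq_exp_mul_log {t : ℝ} (ht : 0 < t) (x : ℝ) : t ^ x = Real.exp (x * Real.log t) := by
  rw [Real.rpow_def_of_pos ht, mul_comm]

lemma expSumVanish_log {J : Finset ℕ} {s c : ℕ → ℝ} {f : ℝ → ℝ}
    (hf : ∀ t : ℝ, 0 < t → f t = ∑ j ∈ J, c j * t ^ s j) {p : ℕ} {t : ℝ} (ht : 0 < t)
    (h : ∀ i < p, iteratedDeriv i f t = 0) : ExpSumVanish J s c p (Real.log t) := by
  have key : ∀ i l : ℕ, i + l < p → expSum J s
      (fun j => c j * (descPochhammer ℝ l).eval (s j) * s j ^ i) (Real.log t) = 0 := by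
    intro i
    induction i with
    | zero =>
      intro l hl
      have h1 := h l (by omega)
      rw [iteratedDeriv_sum_rpow hf l t ht] at h1
      have h2 : expSum J s (fun j => c j * (descPochhammer ℝ l).eval (s j) * s j ^ 0) (Real.log t)
          = t ^ (l : ℝ) *
            ∑ j ∈ J, c j * (descPochhammer ℝ l).eval (s j) * t ^ (s j - l) := by
        rw [Finset.mul_sum]
        refine Finset.sum_congr rfl fun j _ => ?_
        rw [← rpow_eq_exp_mul_log ht, Real.rpow_sub ht]
        have : t ^ (l : ℝ) ≠ 0 := (Real.rpow_pos_of_pos ht _).ne'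
        field_simp
      rw [h2, h1, mul_zero]
    | succ i ih =>
      intro l hl
      have h1 := ih (l + 1) (by omega)
      have h2 := ih l (by omega)
      have h3 : expSum J s (fun j => c j * (descPochhammer ℝ l).eval (s j) * s j ^ (i + 1))
            (Real.log t) =
          expSum J s (fun j => c j * (descPochhammer ℝ (l + 1)).eval (s j) * s j ^ i) (Real.log t) +
          l * expSum J s (fun j => c j * (descPochhammer ℝ l).eval (s j) * s j ^ i)
            (Real.log t) := by
        unfold expSum
        rw [Finset.mul_sum, ← Finset.sum_add_distrib]
        refine Finset.sum_congr rfl fun j _ => ?_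
        simp only [descPochhammer_succ_eval]
        ring
      rw [h3, h1, h2, mul_zero, add_zero]
  intro i hi
  simpa using key i 0 (by omega)

/-- The coefficients `b i` (with respect to `exp (s j * x)`, `j ≤ m`) of functions which vanish to
order `i` at `α` and to order `m - i` at `β`, and which sum to `1`. -/
structure IsBernsteinCoeff (s : ℕ → ℝ) (m : ℕ) (α β : ℝ) (b : ℕ → ℕ → ℝ) : Prop where
  lt : α < β
  strictMonoOn : StrictMonoOn s (Finset.range (m + 1))
  left : ∀ i ≤ m, ExpSumVanish (Finset.range (m + 1)) s (b i) i α
  right : ∀ i ≤ m, ExpSumVanish (Finset.range (m + 1)) s (b i) (m - i) β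
  sum_eq : ∀ j ∈ Finset.range (m + 1),
    (if j = 0 then 1 else 0 : ℝ) = ∑ i ∈ Finset.range (m + 1), 1 * b i j

namespace IsBernsteinCoeff

variable {s : ℕ → ℝ} {m : ℕ} {α β : ℝ} {b : ℕ → ℕ → ℝ}

lemma tail_left (hb : IsBernsteinCoeff s m α β b) (e : ℕ → ℝ) (i : ℕ) :
    ExpSumVanish (Finset.range (m + 1)) s
      (fun j => ∑ k ∈ Finset.Ico i (m + 1), e k * b k j) i α :=
  ExpSumVanish.sum fun k hk => by
    rw [Finset.mem_Ico] at hk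
    exact (hb.left k (by omega)).mono hk.1

lemma tail_right (hb : IsBernsteinCoeff s m α β b) {e h : ℕ → ℝ} {i q : ℕ} (hi : i ≤ m)
    (hq : q ≤ i) (he : ∀ k, q ≤ k → k < i → e k = 0)
    (hh : ∀ j ∈ Finset.range (m + 1), h j = ∑ k ∈ Finset.range (m + 1), e k * b k j) :
    ExpSumVanish (Finset.range (m + 1)) s
      (fun j => h j - ∑ k ∈ Finset.Ico i (m + 1), e k * b k j) (m + 1 - q) β := by
  refine ExpSumVanish.congr (f := fun j => ∑ k ∈ Finset.range q, e k * b k j) ?_ ?_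
  · refine ExpSumVanish.sum fun k hk => ?_
    rw [Finset.mem_range] at hk
    exact (hb.right k (by omega)).mono (by omega)
  · intro j hj
    rw [hh j hj, ← Finset.sum_range_add_sum_Ico _ (by omega : i ≤ m + 1),
      ← Finset.sum_range_add_sum_Ico _ hq,
      Finset.sum_eq_zero (s := Finset.Ico q i) (fun k hk => ?_)]
    · ring
    · rw [Finset.mem_Ico] at hk
      rw [he k hk.1 hk.2, zero_mul]

lemma tail_lead (hb : IsBernsteinCoeff s m α β b) (e : ℕ → ℝ) {i : ℕ} (hi : i ≤ m) :
    expSum (Finset.range (m + 1)) s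
        (fun j => (∑ k ∈ Finset.Ico i (m + 1), e k * b k j) * s j ^ i) α =
      e i * expSum (Finset.range (m + 1)) s (fun j => b i j * s j ^ i) α := by
  have h1 : expSum (Finset.range (m + 1)) s
        (fun j => (∑ k ∈ Finset.Ico i (m + 1), e k * b k j) * s j ^ i) α =
      expSum (Finset.range (m + 1)) s
        (fun j => ∑ k ∈ Finset.Ico i (m + 1), e k * (b k j * s j ^ i)) α :=
    expSum_congr (fun j _ => by simp only [Finset.sum_mul, mul_assoc]) α
  rw [h1, expSum_sum _ _ s e (fun k j => b k j * s j ^ i)]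
  refine Finset.sum_eq_single_of_mem i (Finset.mem_Ico.2 ⟨le_rfl, by omega⟩) fun k hk hki => ?_
  rw [Finset.mem_Ico] at hk
  rw [hb.left k (by omega) i (by omega), mul_zero]

lemma lead_pos (hb : IsBernsteinCoeff s m α β b) {i : ℕ} (hi : i ≤ m) :
    0 < expSum (Finset.range (m + 1)) s (fun j => b i j * s j ^ i) α := by
  have h := expSum_pos_of_interpolation hb.strictMonoOn.injOn (l := 0)
    (Finset.mem_range.2 (Nat.succ_pos m)) (h := fun j => if j = 0 then 1 else 0)
    (fun j _ hj => by simp [hj]) (by simp) hb.lt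
    (p := i) (p' := m + 1 - i) (by omega) (by rw [Finset.card_range]; omega)
    (hb.tail_left (fun _ => 1) i)
    (hb.tail_right hi le_rfl (fun k h1 h2 => by omega) hb.sum_eq)
  rwa [hb.tail_lead (fun _ => 1) hi, one_mul] at h

lemma exponent_lt (hb : IsBernsteinCoeff s m α β b) {i j : ℕ} (hij : i < j) (hj : j ≤ m) :
    s i < s j :=
  hb.strictMonoOn (by simp; omega) (by simp; omega) hij

lemma expSum_nonneg (hb : IsBernsteinCoeff s m α β b) {i : ℕ} (hi : i ≤ m) {x : ℝ}
    (hx : x ∈ Set.Icc α β) : 0 ≤ expSum (Finset.range (m + 1)) s (b i) x := by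
  by_contra! hneg
  have hlead := hb.lead_pos hi
  obtain ⟨δ, hδ, H⟩ := exists_expSum_pos (hb.left i hi) hlead
  have hαx : α < x := by
    refine lt_of_le_of_ne hx.1 ?_
    rintro rfl
    rcases Nat.eq_zero_or_pos i with rfl | hpos
    · simp only [pow_zero, mul_one] at hlead
      exact lt_asymm hlead hneg
    · exact hneg.ne ((hb.left i hi).apply_eq_zero hpos)
  obtain ⟨z, hz1, hz2⟩ := exists_between (lt_min (lt_add_of_pos_right α hδ) hαx)
  have hz := H z ⟨hz1, hz2.trans_le (min_le_left _ _)⟩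
  have hzx : z < x := hz2.trans_le (min_le_right _ _)
  obtain ⟨w, hw, hw0⟩ := intermediate_value_Icc' hzx.le
    (continuous_expSum (Finset.range (m + 1)) s (b i)).continuousOn
    (show (0 : ℝ) ∈ Set.Icc _ _ from ⟨hneg.le, hz.le⟩)
  have hwx : w < x := lt_of_le_of_ne hw.2 (by rintro rfl; exact hneg.ne hw0)
  have h0 := expSum_coeff_eq_zero_of_three hb.strictMonoOn.injOn (hz1.trans_le hw.1)
    (hwx.trans_le hx.2) (hb.left i hi) (hb.right i hi) hw0 (by rw [Finset.card_range]; omega)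
  refine hneg.ne (Finset.sum_eq_zero fun j hj => ?_)
  rw [h0 j hj, zero_mul]

/-- The functions with coefficients `b i` are linearly independent. -/
lemma eq_zero_of_sum_eq_zero (hb : IsBernsteinCoeff s m α β b) {e : ℕ → ℝ}
    (he : ∀ j ∈ Finset.range (m + 1), ∑ k ∈ Finset.range (m + 1), e k * b k j = 0) :
    ∀ i ≤ m, e i = 0 := by
  intro i
  induction i using Nat.strong_induction_on with
  | _ i ih =>
    intro hi
    have h := hb.tail_lead e hi
    rw [expSum, Finset.sum_eq_zero] at h
    · exact (mul_eq_zero.1 h.symm).resolve_right (hb.lead_pos hi).ne'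
    · intro j hj
      have h1 := he j hj
      rw [← Finset.sum_range_add_sum_Ico _ (by omega : i ≤ m + 1),
        Finset.sum_eq_zero (s := Finset.range i) (fun k hk => ?_), zero_add] at h1
      · rw [h1, zero_mul, zero_mul]
      · rw [Finset.mem_range] at hk
        rw [ih k hk (by omega), zero_mul]

/-- The coefficients of `exp (s 1 * x)` are strictly increasing. -/
lemma coeff_lt_succ (hb : IsBernsteinCoeff s m α β b) {c : ℕ → ℝ}
    (hc : ∀ j ∈ Finset.range (m + 1),
      (if j = 1 then 1 else 0 : ℝ) = ∑ k ∈ Finset.range (m + 1), c k * b k j)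
    {i : ℕ} (hi : i + 1 ≤ m) : c i < c (i + 1) := by
  have hh : ∀ j ∈ Finset.range (m + 1), (if j = 1 then 1 else 0 : ℝ) - c i * (if j = 0 then 1 else 0)
      = ∑ k ∈ Finset.range (m + 1), (c k - c i) * b k j := by
    intro j hj
    rw [hc j hj, hb.sum_eq j hj, Finset.mul_sum, ← Finset.sum_sub_distrib]
    exact Finset.sum_congr rfl fun k _ => by ring
  have h := expSum_pos_of_interpolation_two hb.strictMonoOn.injOn (l₀ := 0) (l := 1)
    (Finset.mem_range.2 (by omega)) (Finset.mem_range.2 (by omega)) one_ne_zero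
    (h := fun j => (if j = 1 then 1 else 0 : ℝ) - c i * (if j = 0 then 1 else 0))
    (fun j _ h1 h0 => by simp [h1, h0])
    (by simpa using hb.exponent_lt one_pos (by omega)) hb.lt
    (p := i) (p' := m - i) (by omega) (by rw [Finset.card_range]; omega)
    (hb.tail_left (fun k => c k - c i) (i + 1))
    ((hb.tail_right hi (Nat.le_succ i)
      (fun k h1 h2 => by rw [show k = i by omega, sub_self]) hh).mono (by omega))
  rw [hb.tail_lead (fun k => c k - c i) hi] at h
  exact sub_pos.1 (pos_of_mul_pos_left h (hb.lead_pos hi).le)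

/-- The control polygon of the curve `(exp (s 1 * x), exp (s k * x))` is strictly convex. -/
lemma slope_lt_slope (hb : IsBernsteinCoeff s m α β b) {c d : ℕ → ℝ} {k : ℕ} (hk : 1 < k)
    (hkm : k ≤ m)
    (hc : ∀ j ∈ Finset.range (m + 1),
      (if j = 1 then 1 else 0 : ℝ) = ∑ l ∈ Finset.range (m + 1), c l * b l j)
    (hd : ∀ j ∈ Finset.range (m + 1),
      (if j = k then 1 else 0 : ℝ) = ∑ l ∈ Finset.range (m + 1), d l * b l j)
    {i : ℕ} (hi : i + 2 ≤ m) :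
    (d (i + 1) - d i) / (c (i + 1) - c i) <
      (d (i + 2) - d (i + 1)) / (c (i + 2) - c (i + 1)) := by
  have hc1 := hb.coeff_lt_succ hc (i := i) (by omega)
  have hc2 := hb.coeff_lt_succ hc hi
  set σ := (d (i + 1) - d i) / (c (i + 1) - c i) with hσ
  have hσ' : d (i + 1) - d i = σ * (c (i + 1) - c i) := by
    rw [hσ, div_mul_cancel₀ _ (sub_pos.2 hc1).ne']
  set e : ℕ → ℝ := fun l => d l - d i - σ * (c l - c i) with he
  set h : ℕ → ℝ := fun j => (if j = k then 1 else 0) - σ * (if j = 1 then 1 else 0)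
    - (d i - σ * c i) * (if j = 0 then 1 else 0) with hh
  have hsum : ∀ j ∈ Finset.range (m + 1), h j = ∑ l ∈ Finset.range (m + 1), e l * b l j := by
    intro j hj
    simp only [hh]
    rw [hc j hj, hd j hj, hb.sum_eq j hj, Finset.mul_sum, Finset.mul_sum,
      ← Finset.sum_sub_distrib, ← Finset.sum_sub_distrib]
    exact Finset.sum_congr rfl fun l _ => by simp only [he]; ring
  have hpos := expSum_pos_of_interpolation_three hb.strictMonoOn.injOn (l₀ := 0) (l₁ := 1) (l := k)
    (Finset.mem_range.2 (by omega)) (Finset.mem_range.2 (by omega)) (Finset.mem_range.2 (by omega))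
    one_ne_zero (by omega) (by omega) (h := h)
    (fun j _ h1 h2 h3 => by simp [hh, h1, h2, h3])
    (by
      have h0 := sub_pos.2 (hb.exponent_lt (by omega : 0 < k) hkm)
      have h1 := sub_pos.2 (hb.exponent_lt hk hkm)
      have h2 : h k = 1 := by simp [hh, hk.ne', (zero_lt_one.trans hk).ne']
      rw [h2]
      positivity) hb.lt
    (p := i) (p' := m - 1 - i) (by omega) (by rw [Finset.card_range]; omega)
    (hb.tail_left e (i + 2))
    ((hb.tail_right (q := i) hi (by omega)
      (fun l h1 h2 => by
        rcases (by omega : l = i ∨ l = i + 1) with rfl | rfl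
        · simp [he]
        · simp only [he]; linarith) hsum).mono (by omega))
  rw [hb.tail_lead e hi] at hpos
  have hpos' : 0 < e (i + 2) := pos_of_mul_pos_left hpos (hb.lead_pos hi).le
  rw [lt_div_iff₀ (sub_pos.2 hc2)]
  simp only [he] at hpos'
  linarith

end IsBernsteinCoeff

/-- Two exponential sums agreeing on an interval have the same coefficients. -/
lemma expSum_coeff_eq_of_eqOn {J : Finset ℕ} {s f g : ℕ → ℝ} (hs : Set.InjOn s J) {α β : ℝ}
    (hαβ : α < β) (h : ∀ x ∈ Set.Icc α β, expSum J s f x = expSum J s g x) :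
    ∀ j ∈ J, f j = g j := by
  obtain ⟨S, hS, hcard⟩ := (Set.Icc_infinite hαβ).exists_subset_card_eq J.card
  have h0 := expSum_coeff_eq_zero J s hs (fun j => f j - g j) S (fun _ => 1)
    (fun x hx i hi => by
      obtain rfl : i = 0 := by omega
      simp only [pow_zero, mul_one]
      rw [expSum_sub, h x (hS hx), sub_self]) (by simp [hcard])
  exact fun j hj => sub_eq_zero.1 (h0 j hj)

/-- A sequence of points with increasing abscissae and increasing slopes lies above the line
through any two consecutive points. -/
lemma exists_support_line {m : ℕ} (hm : 1 ≤ m) {c d : ℕ → ℝ} (hc : ∀ i, i + 1 ≤ m → c i < c (i + 1))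
    (hslope : ∀ i, i + 2 ≤ m → (d (i + 1) - d i) / (c (i + 1) - c i) ≤
      (d (i + 2) - d (i + 1)) / (c (i + 2) - c (i + 1))) {i : ℕ} (hi : i ≤ m) :
    ∃ σ : ℝ, ∀ j ≤ m, 0 ≤ d j - d i - σ * (c j - c i) := by
  set S : ℕ → ℝ := fun i => (d (i + 1) - d i) / (c (i + 1) - c i) with hS
  have hmono : ∀ p q, p ≤ q → q + 1 ≤ m → S p ≤ S q := by
    intro p q hpq
    induction q, hpq using Nat.le_induction with
    | base => exact fun _ => le_rfl
    | succ q _ ih => exact fun hq => (ih (by omega)).trans (hslope q hq)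
  have hstep : ∀ p, p + 1 ≤ m → d (p + 1) - d p = S p * (c (p + 1) - c p) := fun p hp =>
    (div_mul_cancel₀ _ (sub_pos.2 (hc p hp)).ne').symm
  obtain ⟨σ, hr, hl⟩ : ∃ σ : ℝ, (∀ p, i ≤ p → p + 1 ≤ m → σ ≤ S p) ∧ ∀ p, p + 1 ≤ i → S p ≤ σ := by
    rcases Nat.lt_or_ge i m with him | him
    · exact ⟨S i, fun p h1 h2 => hmono i p h1 h2, fun p h1 => hmono p i (by omega) him⟩
    · exact ⟨S (m - 1), fun p h1 h2 => by omega, fun p h1 => hmono p (m - 1) (by omega) (by omega)⟩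
  refine ⟨σ, fun j hj => ?_⟩
  rcases le_total i j with hij | hij
  · induction j, hij using Nat.le_induction with
    | base => simp
    | succ q hq ih =>
      have h1 := ih (by omega)
      have h2 := hstep q hj
      have h3 := mul_le_mul_of_nonneg_right (hr q hq hj) (sub_pos.2 (hc q hj)).le
      linarith
  · induction hij using Nat.decreasingInduction with
    | self => simp
    | of_succ q hq ih =>
      have h1 := ih (by omega)
      have h2 := hstep q (by omega)
      have h3 := mul_le_mul_of_nonneg_right (hl q hq) (sub_pos.2 (hc q (by omega))).le
      linarith

/-- If `c` and `d` are the Chebyshev–Bézier control coefficients on `[a,1]` of `t^{r_1}` and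
`t^{r_k}` respectively, then `c_i ≥ 0` and `(c_i)^{r_k/r_1} ≥ d_i` for all `i`. -/
theorem chebBezier_control_points_convexity (r : ℕ → ℝ) (m : ℕ) (hr0 : r 0 = 0)
    (hmono : ∀ i, i < m → r i < r (i + 1)) (a : ℝ) (ha : 0 < a) (ha1 : a < 1)
    (B : ℕ → ℝ → ℝ) (hB : IsChebBernstein r m a 1 B)
    (k : ℕ) (hk1 : 1 ≤ k) (hkm : k ≤ m) (c d : ℕ → ℝ)
    (hc : ∀ t ∈ Set.Icc a 1, t ^ r 1 = ∑ i ∈ Finset.range (m + 1), B i t * c i)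
    (hd : ∀ t ∈ Set.Icc a 1, t ^ r k = ∑ i ∈ Finset.range (m + 1), B i t * d i) :
    ∀ i ≤ m, 0 ≤ c i ∧ d i ≤ (c i) ^ (r k / r 1) := by
  obtain ⟨hspan, hone, hleft, hright⟩ := hB
  choose! b hb using hspan
  have hαβ : Real.log a < 0 := Real.log_neg ha ha1
  have hstrict : StrictMonoOn r (Finset.range (m + 1)) := by
    intro i _ j hj hij
    rw [Finset.coe_range, Set.mem_Iio] at hj
    induction j, hij using Nat.le_induction with
    | base => exact hmono i (by omega)
    | succ j _ ih => exact (ih (by omega)).trans (hmono j (by omega))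
  have hBexp : ∀ i ≤ m, ∀ t : ℝ, 0 < t →
      B i t = expSum (Finset.range (m + 1)) r (b i) (Real.log t) := fun i hi t ht => by
    rw [hb i hi t ht]
    exact Finset.sum_congr rfl fun j _ => by rw [rpow_eq_exp_mul_log ht]
  have hcoeff : ∀ l ≤ m, ∀ e : ℕ → ℝ,
      (∀ t ∈ Set.Icc a 1, t ^ r l = ∑ i ∈ Finset.range (m + 1), B i t * e i) →
      ∀ j ∈ Finset.range (m + 1),
        (if j = l then 1 else 0 : ℝ) = ∑ i ∈ Finset.range (m + 1), e i * b i j := by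
    intro l hl e he
    refine expSum_coeff_eq_of_eqOn hstrict.injOn hαβ fun x hx => ?_
    have hx' : Real.exp x ∈ Set.Icc a 1 :=
      ⟨(Real.log_le_iff_le_exp ha).1 hx.1, Real.exp_le_one_iff.2 hx.2⟩
    have h1 := he _ hx'
    rw [rpow_eq_exp_mul_log (Real.exp_pos x), Real.log_exp] at h1
    rw [expSum_sum]
    refine Eq.trans ?_ (h1.trans (Finset.sum_congr rfl fun i hi => ?_))
    · simp [expSum, Nat.lt_succ_iff.2 hl]
    · rw [hBexp i (Nat.lt_succ_iff.1 (Finset.mem_range.1 hi)) _ (Real.exp_pos x), Real.log_exp,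
        mul_comm]
  have hbc : IsBernsteinCoeff r m (Real.log a) 0 b :=
    { lt := hαβ
      strictMonoOn := hstrict
      left := fun i hi => expSumVanish_log (hb i hi) ha (hleft i hi)
      right := fun i hi => by
        rw [← Real.log_one]
        exact expSumVanish_log (hb i hi) one_pos (hright i hi)
      sum_eq := hcoeff 0 (Nat.zero_le m) (fun _ => 1) fun t ht => by
        rw [hr0, Real.rpow_zero]
        exact (hone t ht).symm.trans (Finset.sum_congr rfl fun i _ => (mul_one _).symm) }
  have hBnonneg : ∀ i ≤ m, ∀ t ∈ Set.Icc a 1, 0 ≤ B i t := fun i hi t ht => by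
    have ht0 : 0 < t := ha.trans_le ht.1
    rw [hBexp i hi t ht0]
    exact hbc.expSum_nonneg hi ⟨Real.log_le_log ha ht.1, Real.log_nonpos ht0.le ht.2⟩
  have hr1 : 0 < r 1 := by
    have := hmono 0 (by omega)
    rwa [hr0] at this
  have hc' := hcoeff 1 (by omega) c hc
  have hd' := hcoeff k hkm d hd
  have hclt : ∀ i, i + 1 ≤ m → c i < c (i + 1) := fun i hi => hbc.coeff_lt_succ hc' hi
  have hcmono : ∀ p q, p ≤ q → q ≤ m → c p ≤ c q := by
    intro p q hpq
    induction q, hpq using Nat.le_induction with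
    | base => exact fun _ => le_rfl
    | succ q _ ih => exact fun hq => (ih (by omega)).trans (hclt q hq).le
  have hc0 : a ^ r 1 = c 0 := by
    have hzero : ∀ i ∈ Finset.range (m + 1), i ≠ 0 → B i a = 0 := fun i hi h0 => by
      simpa using hleft i (by simpa [Nat.lt_succ_iff] using hi) 0 (Nat.pos_of_ne_zero h0)
    have h1 := hone a ⟨le_rfl, ha1.le⟩
    rw [Finset.sum_eq_single_of_mem 0 (by simp) hzero] at h1
    rw [hc a ⟨le_rfl, ha1.le⟩, Finset.sum_eq_single_of_mem 0 (by simp)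
      (fun i hi h0 => by rw [hzero i hi h0, zero_mul]), h1, one_mul]
  have hcm : c m = 1 := by
    have hzero : ∀ i ∈ Finset.range (m + 1), i ≠ m → B i 1 = 0 := fun i hi h0 => by
      rw [Finset.mem_range] at hi
      simpa using hright i (by omega) 0 (by omega)
    have h1 := hone 1 ⟨ha1.le, le_rfl⟩
    rw [Finset.sum_eq_single_of_mem m (by simp) hzero] at h1
    have h2 := hc 1 ⟨ha1.le, le_rfl⟩
    rw [Finset.sum_eq_single_of_mem m (by simp)
      (fun i hi h0 => by rw [hzero i hi h0, zero_mul]), h1, one_mul, Real.one_rpow] at h2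
    exact h2.symm
  intro i hi
  have hci : a ^ r 1 ≤ c i := hc0 ▸ hcmono 0 i (Nat.zero_le i) hi
  have hci0 : 0 ≤ c i := (Real.rpow_pos_of_pos ha _).le.trans hci
  have hci1 : c i ≤ 1 := hcm ▸ hcmono i m hi le_rfl
  refine ⟨hci0, ?_⟩
  rcases hk1.eq_or_lt with rfl | hk
  · rw [div_self hr1.ne', Real.rpow_one]
    refine (sub_eq_zero.1 (hbc.eq_zero_of_sum_eq_zero (e := fun l => d l - c l) (fun j hj => ?_)
      i hi)).le
    rw [← sub_self (if j = 1 then 1 else 0 : ℝ)]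
    nth_rewrite 1 [hd' j hj]
    rw [hc' j hj, ← Finset.sum_sub_distrib]
    exact Finset.sum_congr rfl fun l _ => sub_mul _ _ _
  · obtain ⟨σ, hσ⟩ := exists_support_line (by omega) hclt
      (fun i hi => (hbc.slope_lt_slope hk hkm hc' hd' hi).le) hi
    set t := c i ^ (r 1)⁻¹ with ht
    have htr : t ^ r 1 = c i := Real.rpow_inv_rpow hci0 hr1.ne'
    have htk : t ^ r k = c i ^ (r k / r 1) := by
      rw [ht, ← Real.rpow_mul hci0, inv_mul_eq_div]
    have htmem : t ∈ Set.Icc a 1 := by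
      refine ⟨?_, Real.rpow_le_one hci0 hci1 (inv_nonneg.2 hr1.le)⟩
      rw [← Real.rpow_rpow_inv ha.le hr1.ne']
      exact Real.rpow_le_rpow (Real.rpow_nonneg ha.le _) hci (inv_nonneg.2 hr1.le)
    have hsum : 0 ≤ ∑ j ∈ Finset.range (m + 1), B j t * (d j - d i - σ * (c j - c i)) :=
      Finset.sum_nonneg fun j hj => by
        rw [Finset.mem_range, Nat.lt_succ_iff] at hj
        exact mul_nonneg (hBnonneg j hj t htmem) (hσ j hj)
    have heq : ∑ j ∈ Finset.range (m + 1), B j t * (d j - d i - σ * (c j - c i)) =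
        t ^ r k - σ * t ^ r 1 - (d i - σ * c i) * 1 := by
      rw [hc t htmem, hd t htmem, ← hone t htmem, Finset.mul_sum, Finset.mul_sum,
        ← Finset.sum_sub_distrib, ← Finset.sum_sub_distrib]
      exact Finset.sum_congr rfl fun j _ => by ring
    rw [heq, htr, htk] at hsum
    linarith
end

section
/- (Necessity direction of the main theorem) Let 0 = r_0 < r_1 < ... < r_m < ... be an infinite strictly increasing sequence of real numbers with ∑_{i=1}^∞ 1/r_i < ∞, and let 0 < a < 1. Fix n ≥ 1 and a_0,...,a_n ∈ ℝ, and let P(t) = a_0 + ∑_{k=1}^n a_k t^{r_k}; assume P′(a) ≠ 0. For each m ≥ n, let (B^m_0,...,B^m_m) be the Chebyshev–Bernstein basis of E(Λ_m) on [a,1] and let b^m_0,...,b^m_m ∈ ℝ be the coefficients with P(t) = ∑_{i=0}^m B^m_i(t) b^m_i on [a,1]. Then there exists δ > 0 such that |b^m_0 − b^m_1| ≥ δ for all m ≥ n; in particular the first edge of the control polygon does not shrink and the dimension elevation algorithm does not converge to the curve. -/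
open Filter Topology

/-- The coefficients, in the basis `s ↦ exp (-r k * s)`, of the cumulative distribution function
of a sum of independent exponential variables with rates `r 1, ..., r m` (when `r 0 = 0`). -/
noncomputable def hypoexpCoeff (r : ℕ → ℝ) : ℕ → ℕ → ℝ
  | 0, _ => 1
  | m + 1, k =>
    if k ≤ m then hypoexpCoeff r m k * (r (m + 1) / (r (m + 1) - r k))
    else -∑ j ∈ Finset.range (m + 1), hypoexpCoeff r m j * (r (m + 1) / (r (m + 1) - r j))

/-- The cumulative distribution function of a sum of independent exponential variables with rates
`r 1, ..., r m` (when `r 0 = 0`). -/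
noncomputable def hypoexpCDF (r : ℕ → ℝ) (m : ℕ) (s : ℝ) : ℝ :=
  ∑ k ∈ Finset.range (m + 1), hypoexpCoeff r m k * Real.exp (-(r k * s))

/-- The derivative of `hypoexpCDF r (m + 1)`. -/
noncomputable def hypoexpPDF (r : ℕ → ℝ) (m : ℕ) (s : ℝ) : ℝ :=
  r (m + 1) * (hypoexpCDF r m s - hypoexpCDF r (m + 1) s)

section LinearODE

variable {R T : ℝ} {f h : ℝ → ℝ}

theorem hasDerivAt_exp_mul_of_linearODE (hf : ∀ s, HasDerivAt f (R * (h s - f s)) s) (s : ℝ) :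
    HasDerivAt (fun s => Real.exp (R * s) * f s) (R * Real.exp (R * s) * h s) s := by
  have h1 : HasDerivAt (fun s : ℝ => Real.exp (R * s)) (Real.exp (R * s) * (R * 1)) s :=
    ((hasDerivAt_id s).const_mul R).exp
  exact (h1.mul (hf s)).congr_deriv (by ring)

theorem nonneg_of_linearODE (hR : 0 ≤ R) (hf : ∀ s, HasDerivAt f (R * (h s - f s)) s)
    (h0 : 0 ≤ f 0) (hh : ∀ s ∈ Set.Icc 0 T, 0 ≤ h s) : ∀ s ∈ Set.Icc 0 T, 0 ≤ f s := by
  intro s hs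
  have hd := hasDerivAt_exp_mul_of_linearODE hf
  have hmon : MonotoneOn (fun s => Real.exp (R * s) * f s) (Set.Icc 0 T) := by
    refine monotoneOn_of_deriv_nonneg (convex_Icc 0 T)
      (fun x _ => (hd x).continuousAt.continuousWithinAt)
      (fun x _ => (hd x).differentiableAt.differentiableWithinAt) fun x hx => ?_
    rw [(hd x).deriv]
    exact mul_nonneg (by positivity) (hh x (interior_subset hx))
  have h1 := hmon ⟨le_rfl, hs.1.trans hs.2⟩ hs hs.1
  simp only [mul_zero, Real.exp_zero, one_mul] at h1
  exact nonneg_of_mul_nonneg_right (h0.trans h1) (Real.exp_pos _)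

theorem pos_of_linearODE (hR : 0 < R) (hf : ∀ s, HasDerivAt f (R * (h s - f s)) s)
    (h0 : 0 ≤ f 0) (hh : ∀ s, 0 < s → 0 < h s) : ∀ s, 0 < s → 0 < f s := by
  intro s hs
  have hd := hasDerivAt_exp_mul_of_linearODE hf
  have hmon : StrictMonoOn (fun s => Real.exp (R * s) * f s) (Set.Ici 0) := by
    refine strictMonoOn_of_deriv_pos (convex_Ici 0)
      (fun x _ => (hd x).continuousAt.continuousWithinAt) fun x hx => ?_
    rw [interior_Ici] at hx
    rw [(hd x).deriv]
    exact mul_pos (by positivity) (hh x hx)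
  have h1 := hmon Set.self_mem_Ici hs.le hs
  simp only [mul_zero, Real.exp_zero, one_mul] at h1
  exact pos_of_mul_pos_right (h0.trans_lt h1) (Real.exp_pos _).le

end LinearODE

section Hypoexponential

variable {r : ℕ → ℝ}

theorem StrictMono.pos_succ_of_zero (hmono : StrictMono r) (hr0 : r 0 = 0) (m : ℕ) :
    0 < r (m + 1) :=
  hr0 ▸ hmono m.succ_pos

theorem sum_hypoexpCoeff_succ (r : ℕ → ℝ) (m : ℕ) :
    ∑ k ∈ Finset.range (m + 2), hypoexpCoeff r (m + 1) k = 0 := by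
  rw [Finset.sum_range_succ, hypoexpCoeff, if_neg (by omega), ← sub_eq_add_neg, sub_eq_zero]
  refine Finset.sum_congr rfl fun k hk => ?_
  rw [hypoexpCoeff, if_pos (Finset.mem_range_succ_iff.mp hk)]

theorem hypoexpCoeff_succ_mul (hmono : StrictMono r) {m k : ℕ} (hk : k ≤ m) :
    hypoexpCoeff r (m + 1) k * (r (m + 1) - r k) = r (m + 1) * hypoexpCoeff r m k := by
  have : r (m + 1) - r k ≠ 0 := (sub_pos.2 (hmono (Nat.lt_succ_of_le hk))).ne'
  rw [hypoexpCoeff, if_pos hk]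
  field_simp

theorem hypoexpCDF_zero (hr0 : r 0 = 0) (s : ℝ) : hypoexpCDF r 0 s = 1 := by
  simp [hypoexpCDF, hypoexpCoeff, hr0]

theorem hypoexpCDF_succ_zero (r : ℕ → ℝ) (m : ℕ) : hypoexpCDF r (m + 1) 0 = 0 := by
  simpa [hypoexpCDF] using sum_hypoexpCoeff_succ r m

theorem hasDerivAt_hypoexpCDF_succ (hmono : StrictMono r) (m : ℕ) (s : ℝ) :
    HasDerivAt (hypoexpCDF r (m + 1)) (hypoexpPDF r m s) s := by
  have h1 : HasDerivAt (hypoexpCDF r (m + 1)) (∑ k ∈ Finset.range (m + 2),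
      hypoexpCoeff r (m + 1) k * (Real.exp (-(r k * s)) * -(r k * 1))) s :=
    HasDerivAt.fun_sum fun k _ => (((hasDerivAt_id s).const_mul (r k)).neg.exp).const_mul _
  refine h1.congr_deriv ?_
  have h2 : r (m + 1) * hypoexpCDF r m s = ∑ k ∈ Finset.range (m + 2),
      hypoexpCoeff r (m + 1) k * (r (m + 1) - r k) * Real.exp (-(r k * s)) := by
    rw [Finset.sum_range_succ, sub_self, mul_zero, zero_mul, add_zero, hypoexpCDF,
      Finset.mul_sum]
    refine Finset.sum_congr rfl fun k hk => ?_
    rw [hypoexpCoeff_succ_mul hmono (Finset.mem_range_succ_iff.mp hk), mul_assoc]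
  rw [hypoexpPDF, mul_sub, h2, hypoexpCDF, Finset.mul_sum, ← Finset.sum_sub_distrib]
  exact Finset.sum_congr rfl fun k _ => by ring

theorem hasDerivAt_hypoexpPDF_zero (hr0 : r 0 = 0) (hmono : StrictMono r) (s : ℝ) :
    HasDerivAt (hypoexpPDF r 0) (r 1 * (0 - hypoexpPDF r 0 s)) s := by
  have h1 : hypoexpPDF r 0 = fun x => r 1 * (1 - hypoexpCDF r 1 x) := by
    funext x
    simp [hypoexpPDF, hypoexpCDF_zero hr0]
  rw [zero_sub]
  nth_rewrite 1 [h1]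
  exact ((hasDerivAt_hypoexpCDF_succ hmono 0 s).const_sub 1).const_mul (r 1)

theorem hasDerivAt_hypoexpPDF_succ (hmono : StrictMono r) (m : ℕ) (s : ℝ) :
    HasDerivAt (hypoexpPDF r (m + 1))
      (r (m + 2) * (hypoexpPDF r m s - hypoexpPDF r (m + 1) s)) s :=
  ((hasDerivAt_hypoexpCDF_succ hmono m s).sub
    (hasDerivAt_hypoexpCDF_succ hmono (m + 1) s)).const_mul _

theorem hypoexpCDF_pos (hr0 : r 0 = 0) (hmono : StrictMono r) (m : ℕ) :
    ∀ s, 0 < s → 0 < hypoexpCDF r m s := by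
  induction m with
  | zero => intro s _; simp [hypoexpCDF_zero hr0]
  | succ m ih =>
    exact pos_of_linearODE (hmono.pos_succ_of_zero hr0 m) (hasDerivAt_hypoexpCDF_succ hmono m)
      (hypoexpCDF_succ_zero r m).ge ih

theorem hypoexpCDF_nonneg (hr0 : r 0 = 0) (hmono : StrictMono r) (m : ℕ) {s : ℝ} (hs : 0 ≤ s) :
    0 ≤ hypoexpCDF r m s := by
  rcases hs.eq_or_lt with rfl | hs
  · cases m with
    | zero => simp [hypoexpCDF_zero hr0]
    | succ m => exact (hypoexpCDF_succ_zero r m).ge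
  · exact (hypoexpCDF_pos hr0 hmono m s hs).le

theorem hypoexpPDF_mem_Icc (hr0 : r 0 = 0) (hmono : StrictMono r) (T : ℝ) (m : ℕ) :
    ∀ s ∈ Set.Icc 0 T, hypoexpPDF r m s ∈ Set.Icc 0 (r 1) := by
  have hr1 : 0 < r 1 := hmono.pos_succ_of_zero hr0 0
  induction m with
  | zero =>
    intro s hs
    refine ⟨nonneg_of_linearODE hr1.le (hasDerivAt_hypoexpPDF_zero hr0 hmono) ?_
      (fun _ _ => le_rfl) s hs, ?_⟩
    · simp [hypoexpPDF, hypoexpCDF_zero hr0, hypoexpCDF_succ_zero r 0, hr1.le]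
    · have := mul_nonneg hr1.le (hypoexpCDF_nonneg hr0 hmono 1 hs.1)
      simp only [hypoexpPDF, hypoexpCDF_zero hr0, zero_add]
      linarith
  | succ m ih =>
    have hR : 0 < r (m + 2) := hmono.pos_succ_of_zero hr0 (m + 1)
    have h0 : 0 ≤ hypoexpPDF r (m + 1) 0 ∧ hypoexpPDF r (m + 1) 0 = 0 := by
      simp [hypoexpPDF, hypoexpCDF_succ_zero]
    intro s hs
    refine ⟨nonneg_of_linearODE hR.le (hasDerivAt_hypoexpPDF_succ hmono m) h0.1
      (fun x hx => (ih x hx).1) s hs, sub_nonneg.1 ?_⟩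
    refine nonneg_of_linearODE (f := fun x => r 1 - hypoexpPDF r (m + 1) x)
      (h := fun x => r 1 - hypoexpPDF r m x) hR.le (fun x => ?_) ?_
      (fun x hx => sub_nonneg.2 (ih x hx).2) s hs
    · exact ((hasDerivAt_hypoexpPDF_succ hmono m x).const_sub (r 1)).congr_deriv (by ring)
    · simp [h0.2, hr1.le]

theorem antitone_hypoexpCDF (hr0 : r 0 = 0) (hmono : StrictMono r) {s : ℝ} (hs : 0 ≤ s) :
    Antitone fun m => hypoexpCDF r m s :=
  antitone_nat_of_succ_le fun m => sub_nonneg.1 <| nonneg_of_mul_nonneg_right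
    (hypoexpPDF_mem_Icc hr0 hmono s m s ⟨hs, le_rfl⟩).1 (hmono.pos_succ_of_zero hr0 m)

theorem monotoneOn_hypoexpCDF (hr0 : r 0 = 0) (hmono : StrictMono r) (m : ℕ) :
    MonotoneOn (hypoexpCDF r m) (Set.Ici 0) := by
  cases m with
  | zero => intro x _ y _ _; simp [hypoexpCDF_zero hr0]
  | succ m =>
    have hd := hasDerivAt_hypoexpCDF_succ hmono m
    refine monotoneOn_of_deriv_nonneg (convex_Ici 0)
      (fun x _ => (hd x).continuousAt.continuousWithinAt)
      (fun x _ => (hd x).differentiableAt.differentiableWithinAt) fun x hx => ?_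
    rw [(hd x).deriv]
    exact (hypoexpPDF_mem_Icc hr0 hmono x m x ⟨interior_subset hx, le_rfl⟩).1

/-- An affine lower bound for `hypoexpCDF r N` persists for larger indices, after translation by
the expectations of the additional exponential variables. -/
theorem affine_le_hypoexpCDF_add (hr0 : r 0 = 0) (hmono : StrictMono r) {T α β : ℝ} (hα : 0 ≤ α)
    (hβ : 0 ≤ β) {N : ℕ} (hN : ∀ s ∈ Set.Icc 0 T, α * (s - β) ≤ hypoexpCDF r N s) (j : ℕ) :
    ∀ s ∈ Set.Icc 0 T,
      α * (s - (β + ∑ i ∈ Finset.range j, 1 / r (i + N + 1))) ≤ hypoexpCDF r (N + j) s := by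
  induction j with
  | zero => simpa using hN
  | succ j ih =>
    have hR : 0 < r (N + j + 1) := hmono.pos_succ_of_zero hr0 _
    have hsum : ∀ k, 0 ≤ ∑ i ∈ Finset.range k, 1 / r (i + N + 1) := fun k =>
      Finset.sum_nonneg fun i _ => one_div_nonneg.2 (hmono.pos_succ_of_zero hr0 _).le
    intro s hs
    refine sub_nonneg.1 (nonneg_of_linearODE
      (f := fun x => hypoexpCDF r (N + j + 1) x -
        α * (x - (β + ∑ i ∈ Finset.range (j + 1), 1 / r (i + N + 1))))
      (h := fun x => hypoexpCDF r (N + j) x -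
        α * (x - (β + ∑ i ∈ Finset.range j, 1 / r (i + N + 1))))
      hR.le (fun x => ?_) ?_ (fun x hx => sub_nonneg.2 (ih x hx)) s hs)
    · refine ((hasDerivAt_hypoexpCDF_succ hmono (N + j) x).sub
        (((hasDerivAt_id x).sub_const _).const_mul α)).congr_deriv ?_
      rw [hypoexpPDF, Finset.sum_range_succ, add_comm j N]
      field_simp
      ring
    · rw [hypoexpCDF_succ_zero]
      have := mul_nonneg hα (add_nonneg hβ (hsum (j + 1)))
      linarith

theorem exists_pos_le_hypoexpCDF (hr0 : r 0 = 0) (hmono : StrictMono r)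
    (hsum : Summable fun i => 1 / r (i + 1)) {s : ℝ} (hs : 0 < s) :
    ∃ η, 0 < η ∧ ∀ m, η ≤ hypoexpCDF r m s := by
  obtain ⟨N, hN⟩ : ∃ N, ∑' i, 1 / r (i + N + 1) < s / 4 :=
    ((tendsto_sum_nat_add fun i => 1 / r (i + 1)).eventually
      (gt_mem_nhds (show 0 < s / 4 by positivity))).exists
  have hε := hypoexpCDF_pos hr0 hmono N (s / 2) (by positivity)
  set ε := hypoexpCDF r N (s / 2)
  have hbase : ∀ x ∈ Set.Icc 0 s, 2 * ε / s * (x - s / 2) ≤ hypoexpCDF r N x := by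
    rintro x ⟨hx0, hxs⟩
    rcases le_total x (s / 2) with hx | hx
    · exact (mul_nonpos_of_nonneg_of_nonpos (by positivity) (sub_nonpos.2 hx)).trans
        (hypoexpCDF_nonneg hr0 hmono N hx0)
    · calc 2 * ε / s * (x - s / 2) ≤ 2 * ε / s * (s - s / 2) := by gcongr
        _ = ε := by field_simp; ring
        _ ≤ hypoexpCDF r N x :=
          monotoneOn_hypoexpCDF hr0 hmono N (by positivity : (0 : ℝ) ≤ s / 2) hx0 hx
  refine ⟨ε / 2, by positivity, fun m => ?_⟩
  have htail : ∑ i ∈ Finset.range m, 1 / r (i + N + 1) ≤ s / 4 :=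
    (((summable_nat_add_iff (f := fun i => 1 / r (i + 1)) N).2 hsum).sum_le_tsum _
      fun i _ => one_div_nonneg.2 (hmono.pos_succ_of_zero hr0 _).le).trans hN.le
  calc ε / 2 = 2 * ε / s * (s - (s / 2 + s / 4)) := by field_simp; ring
    _ ≤ 2 * ε / s * (s - (s / 2 + ∑ i ∈ Finset.range m, 1 / r (i + N + 1))) := by gcongr
    _ ≤ hypoexpCDF r (N + m) s :=
      affine_le_hypoexpCDF_add hr0 hmono (by positivity) (by positivity) hbase m s ⟨hs.le, le_rfl⟩
    _ ≤ hypoexpCDF r m s := antitone_hypoexpCDF hr0 hmono hs.le (Nat.le_add_left m N)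

end Hypoexponential

section Muntz

variable {r : ℕ → ℝ} {m : ℕ} {f : ℝ → ℝ} {c : ℕ → ℝ}

theorem eventuallyEq_muntz_sum
    (hc : ∀ t : ℝ, 0 < t → f t = ∑ j ∈ Finset.range (m + 1), c j * t ^ r j) {x : ℝ} (hx : 0 < x) :
    f =ᶠ[𝓝 x] fun t => ∑ j ∈ Finset.range (m + 1), c j * t ^ r j :=
  (lt_mem_nhds hx).mono fun t ht => hc t ht

theorem InMuntz.differentiableAt (hf : InMuntz r m f) {x : ℝ} (hx : 0 < x) :
    DifferentiableAt ℝ f x := by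
  obtain ⟨c, hc⟩ := hf
  refine DifferentiableAt.congr_of_eventuallyEq ?_ (eventuallyEq_muntz_sum hc hx)
  exact DifferentiableAt.fun_sum fun k _ =>
    (Real.differentiableAt_rpow_const_of_ne _ hx.ne').const_mul _

theorem iteratedDeriv_muntz_one
    (hc : ∀ t : ℝ, 0 < t → f t = ∑ j ∈ Finset.range (m + 1), c j * t ^ r j) (j : ℕ) :
    iteratedDeriv j f 1 =
      ∑ k ∈ Finset.range (m + 1), c k * (descPochhammer ℝ j).eval (r k) := by
  have hcd : ∀ k, ContDiffAt ℝ j (fun t : ℝ => t ^ r k) 1 := fun k =>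
    Real.contDiffAt_rpow_const_of_ne one_ne_zero
  rw [(eventuallyEq_muntz_sum hc one_pos).iteratedDeriv_eq j,
    iteratedDeriv_fun_sum fun k _ => contDiffAt_const.mul (hcd k)]
  refine Finset.sum_congr rfl fun k _ => ?_
  rw [iteratedDeriv_const_mul_field, iteratedDeriv_eq_iterate, Real.iter_deriv_rpow_const,
    Real.one_rpow, mul_one]

/-- Up to scaling, `hypoexpCoeff r m` are the only coefficients of an element of the Müntz space
vanishing to order `m` at `1`. -/
theorem exists_eq_mul_hypoexpCoeff (hr0 : r 0 = 0) (hmono : StrictMono r) (m : ℕ) (c : ℕ → ℝ)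
    (hc : ∀ j < m, ∑ k ∈ Finset.range (m + 1), c k * (descPochhammer ℝ j).eval (r k) = 0) :
    ∃ κ : ℝ, ∀ k ≤ m, c k = κ * hypoexpCoeff r m k := by
  induction m generalizing c with
  | zero => exact ⟨c 0, fun k hk => by simp [Nat.le_zero.mp hk, hypoexpCoeff]⟩
  | succ m ih =>
    have hR := hmono.pos_succ_of_zero hr0 m
    obtain ⟨κ, hκ⟩ := ih (fun k => c k * (r (m + 1) - r k)) fun j hj => by
      have h1 := hc j (hj.trans m.lt_succ_self)
      have h2 := hc (j + 1) (Nat.succ_lt_succ hj)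
      have h3 : ∑ k ∈ Finset.range (m + 2),
          c k * (r (m + 1) - r k) * (descPochhammer ℝ j).eval (r k) = 0 := by
        calc _ = (r (m + 1) - j) * ∑ k ∈ Finset.range (m + 2),
                c k * (descPochhammer ℝ j).eval (r k) -
              ∑ k ∈ Finset.range (m + 2), c k * (descPochhammer ℝ (j + 1)).eval (r k) := by
              rw [Finset.mul_sum, ← Finset.sum_sub_distrib]
              refine Finset.sum_congr rfl fun k _ => ?_
              rw [descPochhammer_succ_eval]
              ring
          _ = 0 := by rw [h1, h2]; simp
      rw [Finset.sum_range_succ] at h3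
      simpa using h3
    have hlow : ∀ k ≤ m, c k = κ / r (m + 1) * hypoexpCoeff r (m + 1) k := fun k hk => by
      have hne : r (m + 1) - r k ≠ 0 := (sub_pos.2 (hmono (Nat.lt_succ_of_le hk))).ne'
      refine mul_right_cancel₀ hne ?_
      rw [hκ k hk, mul_assoc, hypoexpCoeff_succ_mul hmono hk]
      field_simp
    refine ⟨κ / r (m + 1), fun k hk => ?_⟩
    rcases Nat.le_succ_iff.mp hk with hk | rfl
    · exact hlow k hk
    · have h1 := hc 0 m.succ_pos
      have h2 := sum_hypoexpCoeff_succ r m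
      simp only [descPochhammer_zero, Polynomial.eval_one, mul_one] at h1
      rw [Finset.sum_range_succ] at h1 h2
      rw [Finset.sum_congr rfl fun k hk => hlow k (Finset.mem_range_succ_iff.mp hk),
        ← Finset.mul_sum] at h1
      linear_combination h1 - κ / r (m + 1) * h2

theorem exists_eq_mul_hypoexpCDF (hr0 : r 0 = 0) (hmono : StrictMono r) (hf : InMuntz r m f)
    (hf1 : ∀ j < m, iteratedDeriv j f 1 = 0) :
    ∃ κ : ℝ, ∀ t : ℝ, 0 < t → f t = κ * hypoexpCDF r m (-Real.log t) := by
  obtain ⟨c, hc⟩ := hf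
  obtain ⟨κ, hκ⟩ := exists_eq_mul_hypoexpCoeff hr0 hmono m c fun j hj => by
    rw [← iteratedDeriv_muntz_one hc, hf1 j hj]
  refine ⟨κ, fun t ht => ?_⟩
  rw [hc t ht, hypoexpCDF, Finset.mul_sum]
  refine Finset.sum_congr rfl fun k hk => ?_
  rw [hκ k (Finset.mem_range_succ_iff.mp hk), Real.rpow_def_of_pos ht, mul_assoc]
  ring_nf

end Muntz

namespace IsChebBernstein

variable {r : ℕ → ℝ} {m : ℕ} {a b : ℝ} {B : ℕ → ℝ → ℝ}

theorem apply_zero_left (hB : IsChebBernstein r m a b B) (hab : a ≤ b) : B 0 a = 1 := by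
  rw [← hB.2.1 a ⟨le_rfl, hab⟩, Finset.sum_range_succ', Finset.sum_eq_zero, zero_add]
  intro k hk
  simpa using hB.2.2.1 (k + 1) (Finset.mem_range.mp hk) 0 k.succ_pos

/-- The derivative at the left endpoint only involves the first edge of the control polygon. -/
theorem deriv_left_eq (hB : IsChebBernstein r (m + 1) a b B) (ha : 0 < a) (hab : a < b)
    {P : ℝ → ℝ} (hP : DifferentiableAt ℝ P a) {p : ℕ → ℝ}
    (hPB : ∀ t ∈ Set.Icc a b, P t = ∑ i ∈ Finset.range (m + 2), B i t * p i) :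
    deriv P a = (p 0 - p 1) * deriv (B 0) a := by
  have hmem : a ∈ Set.Icc a b := ⟨le_rfl, hab.le⟩
  have huniq : UniqueDiffWithinAt ℝ (Set.Icc a b) a := uniqueDiffOn_Icc hab a hmem
  have hd : ∀ {Q : ℝ → ℝ} {q : ℕ → ℝ}, DifferentiableAt ℝ Q a →
      (∀ t ∈ Set.Icc a b, Q t = ∑ i ∈ Finset.range (m + 2), B i t * q i) →
      deriv Q a = deriv (B 1) a * q 1 + deriv (B 0) a * q 0 := by
    intro Q q hQ hQB
    have h1 : HasDerivAt (fun t => ∑ i ∈ Finset.range (m + 2), B i t * q i)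
        (∑ i ∈ Finset.range (m + 2), deriv (B i) a * q i) a :=
      HasDerivAt.fun_sum fun i hi => ((hB.1 i (Finset.mem_range_succ_iff.mp hi)).differentiableAt
        ha).hasDerivAt.mul_const _
    rw [huniq.eq_deriv _ hQ.hasDerivAt.hasDerivWithinAt
      (h1.hasDerivWithinAt.congr hQB (hQB a hmem)), Finset.sum_range_succ',
      Finset.sum_range_succ', Finset.sum_eq_zero, zero_add, zero_add]
    intro i hi
    have h2 := hB.2.2.1 (i + 2) (by have := Finset.mem_range.mp hi; omega) 1 (by omega)
    rw [iteratedDeriv_one] at h2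
    rw [show i + 1 + 1 = i + 2 from rfl, h2, zero_mul]
  have h0 := hd (Q := fun _ => 1) (q := fun _ => 1) (differentiableAt_const _)
    fun t ht => by simpa using (hB.2.1 t ht).symm
  rw [deriv_const] at h0
  rw [hd hP hPB]
  linear_combination -p 1 * h0

theorem abs_deriv_zero_left_le (hr0 : r 0 = 0) (hmono : StrictMono r)
    (hB : IsChebBernstein r (m + 1) a 1 B) (ha : 0 < a) (ha1 : a < 1) :
    |deriv (B 0) a| ≤ r 1 / (a * hypoexpCDF r (m + 1) (-Real.log a)) := by
  have hs : 0 < -Real.log a := neg_pos.2 (Real.log_neg ha ha1)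
  have hF := hypoexpCDF_pos hr0 hmono (m + 1) _ hs
  have hf := hypoexpPDF_mem_Icc hr0 hmono _ m _ ⟨hs.le, le_rfl⟩
  obtain ⟨κ, hκ⟩ := exists_eq_mul_hypoexpCDF hr0 hmono (hB.1 0 (Nat.zero_le _))
    fun j hj => hB.2.2.2 0 (Nat.zero_le _) j hj
  have hκa : κ * hypoexpCDF r (m + 1) (-Real.log a) = 1 := by
    rw [← hκ a ha, hB.apply_zero_left ha1.le]
  have hd : HasDerivAt (B 0) (κ * (hypoexpPDF r m (-Real.log a) * -a⁻¹)) a :=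
    (((hasDerivAt_hypoexpCDF_succ hmono m _).comp a
      (Real.hasDerivAt_log ha.ne').neg).const_mul κ).congr_of_eventuallyEq
      ((lt_mem_nhds ha).mono fun t ht => hκ t ht)
  rw [hd.deriv, eq_div_of_mul_eq hF.ne' hκa, abs_mul, abs_mul, abs_neg, abs_of_pos (by positivity),
    abs_of_nonneg hf.1, abs_of_pos (inv_pos.2 ha)]
  calc _ = hypoexpPDF r m (-Real.log a) / (a * hypoexpCDF r (m + 1) (-Real.log a)) := by
        field_simp
    _ ≤ _ := by gcongr; exact hf.2

end IsChebBernstein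

/-- **Necessity direction of the main theorem.** If `∑ 1/r_i < ∞`, then for any Müntz curve
`P` with `P'(a) ≠ 0`, the first edge of the control polygon produced by dimension elevation
on `[a,1]` does not shrink: `|b^m_0 - b^m_1| ≥ δ > 0` for all `m ≥ n`. -/
theorem chebBezier_dimension_elevation_not_converge (r : ℕ → ℝ) (hr0 : r 0 = 0)
    (hmono : StrictMono r) (hsum : Summable fun i => 1 / r (i + 1))
    (a : ℝ) (ha : 0 < a) (ha1 : a < 1) (n : ℕ) (hn : 1 ≤ n)
    (A : ℕ → ℝ) (P : ℝ → ℝ)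
    (hP : ∀ t : ℝ, 0 < t → P t = ∑ k ∈ Finset.range (n + 1), A k * t ^ r k)
    (hP' : deriv P a ≠ 0)
    (B : ℕ → ℕ → ℝ → ℝ) (hB : ∀ m, IsChebBernstein r m a 1 (B m))
    (b : ℕ → ℕ → ℝ)
    (hb : ∀ m, n ≤ m → ∀ t ∈ Set.Icc a 1, P t = ∑ i ∈ Finset.range (m + 1), B m i t * b m i) :
    ∃ δ : ℝ, 0 < δ ∧ ∀ m, n ≤ m → δ ≤ |b m 0 - b m 1| := by
  have hr1 : 0 < r 1 := hmono.pos_succ_of_zero hr0 0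
  obtain ⟨η, hη, hle⟩ := exists_pos_le_hypoexpCDF hr0 hmono hsum
    (neg_pos.2 (Real.log_neg ha ha1))
  have hPd : 0 < |deriv P a| := abs_pos.2 hP'
  refine ⟨|deriv P a| / (r 1 / (a * η)), by positivity, fun m hm => ?_⟩
  obtain ⟨m, rfl⟩ := Nat.exists_eq_add_of_le' (hn.trans hm)
  rw [div_le_iff₀ (by positivity),
    (hB (m + 1)).deriv_left_eq ha ha1 (InMuntz.differentiableAt ⟨A, hP⟩ ha) (hb (m + 1) hm),
    abs_mul]
  gcongr
  refine ((hB (m + 1)).abs_deriv_zero_left_le hr0 hmono ha ha1).trans ?_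
  gcongr
  exact hle (m + 1)
end

section
/- (Splitting formula for generalized Schur functions) Let η = (λ_1,...,λ_k, μ_1,...,μ_h) be a real partition of length k+h (i.e. η_1 > η_2 − 1 > ... > η_{k+h} − (k+h−1) > −(k+h)), let z_1,...,z_k be pairwise distinct positive reals and y_1,...,y_h pairwise distinct positive reals. Write λ = (λ_1,...,λ_k), μ = (μ_1,...,μ_h) and |μ| = μ_1 + ... + μ_h. Then lim_{ε→0⁺} S_η(z_1,...,z_k, εy_1,...,εy_h)/ε^{|μ|} = S_λ(z_1,...,z_k) · S_μ(y_1,...,y_h), where the limit is taken over those ε > 0 for which the k+h arguments z_1,...,z_k, εy_1,...,εy_h are pairwise distinct. -/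
open Filter Topology

/-- The generalized Schur function `S_λ(u_1, ..., u_n)` for a finite sequence `λ` of real
numbers and (pairwise distinct) positive reals `u_1, ..., u_n`; `u ^ r` is the real power. -/
noncomputable def schur (n : ℕ) (lam : Fin n → ℝ) (u : Fin n → ℝ) : ℝ :=
  Matrix.det (Matrix.of fun i j : Fin n => u i ^ (lam j + n - (j.val + 1))) /
    ∏ j : Fin n, ∏ i ∈ Finset.univ.filter (· < j), (u i - u j)

/-- `λ = (λ_1, ..., λ_n)` is a real partition: `λ_1 > λ_2 - 1 > ... > λ_n - (n-1) > -n`. -/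
def IsRealPartition (n : ℕ) (lam : Fin n → ℝ) : Prop :=
  (∀ i j : Fin n, i < j → lam j - j.val < lam i - i.val) ∧
  (∀ i : Fin n, -(n : ℝ) < lam i - i.val)

/-- The Vandermonde product `∏_{i<j} (u_i - u_j)`. -/
noncomputable def vandermondeProd (n : ℕ) (u : Fin n → ℝ) : ℝ :=
  ∏ j : Fin n, ∏ i ∈ Finset.univ.filter (· < j), (u i - u j)

theorem vandermondeProd_append (k h : ℕ) (u : Fin k → ℝ) (v : Fin h → ℝ) :
    vandermondeProd (k + h) (Fin.append u v) =
      vandermondeProd k u * ((∏ j, ∏ i, (u i - v j)) * vandermondeProd h v) := by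
  have hlt (i : Fin k) (j : Fin h) : Fin.castAdd h i < Fin.natAdd k j := by
    simp only [Fin.lt_def, Fin.val_castAdd, Fin.val_natAdd]; omega
  have hnlt (i : Fin k) (j : Fin h) : ¬ Fin.natAdd k j < Fin.castAdd h i := (hlt i j).not_gt
  have hcast (i j : Fin k) : Fin.castAdd h i < Fin.castAdd h j ↔ i < j := Iff.rfl
  have hnat (i j : Fin h) : Fin.natAdd k i < Fin.natAdd k j ↔ i < j := by
    simp only [Fin.lt_def, Fin.val_natAdd]; omega
  simp only [vandermondeProd, Finset.prod_filter, Fin.prod_univ_add, Fin.append_left,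
    Fin.append_right, hlt, hnlt, if_true, if_false, Finset.prod_const_one, one_mul,
    Finset.prod_mul_distrib, hcast, hnat, mul_assoc]

theorem vandermondeProd_const_mul (h : ℕ) (ε : ℝ) (hε : 0 < ε) (y : Fin h → ℝ) :
    vandermondeProd h (fun i => ε * y i) =
      ε ^ (∑ j : Fin h, ((h : ℝ) - (j.val + 1))) * vandermondeProd h y := by
  have hsum : ∑ j : Fin h, ((h : ℝ) - (j.val + 1)) = ∑ j : Fin h, (j.val : ℝ) := by
    rw [← Equiv.sum_comp Fin.revPerm]
    refine Finset.sum_congr rfl fun j _ => ?_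
    rw [Fin.revPerm_apply, Fin.val_rev, Nat.cast_sub (by omega)]
    push_cast
    ring
  rw [hsum, Real.rpow_sum_of_pos hε]
  simp only [vandermondeProd, ← mul_sub, Finset.prod_mul_distrib, Finset.prod_const,
    Real.rpow_natCast]
  congr 1
  refine Finset.prod_congr rfl fun j _ => ?_
  rw [Finset.filter_gt_eq_Iio, Fin.card_Iio]

/-- If the entries of a block matrix scale like `ε ^ a`, `ε ^ b` in the lower rows, then the powers
`ε ^ b` can be pulled out of the determinant, leaving a matrix whose off-diagonal blocks carry the
powers `ε ^ (m - b)` and `ε ^ (a - m)`. -/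
theorem det_fromBlocks_rpow {ι κ : Type*} [Fintype ι] [DecidableEq ι] [Fintype κ] [DecidableEq κ]
    (A : Matrix ι ι ℝ) (B : Matrix ι κ ℝ) (C : Matrix κ ι ℝ) (D : Matrix κ κ ℝ)
    (a : ι → ℝ) (b : κ → ℝ) (m : ℝ) {ε : ℝ} (hε : 0 < ε) :
    (Matrix.fromBlocks A B (Matrix.of fun i j => ε ^ a j * C i j)
        (Matrix.of fun i j => ε ^ b j * D i j)).det =
      ε ^ (∑ j, b j) *
        (Matrix.fromBlocks A (Matrix.of fun i j => ε ^ (m - b j) * B i j)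
          (Matrix.of fun i j => ε ^ (a j - m) * C i j) D).det := by
  set N := Matrix.fromBlocks A (Matrix.of fun i j => ε ^ (m - b j) * B i j)
          (Matrix.of fun i j => ε ^ (a j - m) * C i j) D with hN
  have key : Matrix.fromBlocks A B (Matrix.of fun i j => ε ^ a j * C i j)
        (Matrix.of fun i j => ε ^ b j * D i j) =
      Matrix.of fun i j => Sum.elim (fun _ => 1) (fun _ => ε ^ m) i *
        (Matrix.of fun i j => Sum.elim (fun _ => 1) (fun j => ε ^ (b j - m)) j * N i j) i j := by
    ext (i | i) (j | j)
    · simp [hN]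
    · simp [hN, ← mul_assoc, ← Real.rpow_add hε]
    · simp [hN, ← mul_assoc, ← Real.rpow_add hε]
    · simp [hN, ← mul_assoc, ← Real.rpow_add hε]
  rw [key, Matrix.det_mul_column, Matrix.det_mul_row, ← mul_assoc]
  congr 1
  simp only [Fintype.prod_sum_type, Sum.elim_inl, Sum.elim_inr, Finset.prod_const_one, one_mul]
  rw [← Finset.prod_mul_distrib, Real.rpow_sum_of_pos hε]
  refine Finset.prod_congr rfl fun j _ => ?_
  rw [← Real.rpow_add hε]
  congr 1
  ring

theorem tendsto_det_fromBlocks_rpow {ι κ : Type*} [Fintype ι] [DecidableEq ι] [Fintype κ]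
    [DecidableEq κ]
    (A : Matrix ι ι ℝ) (B : Matrix ι κ ℝ) (C : Matrix κ ι ℝ) (D : Matrix κ κ ℝ)
    (a : ι → ℝ) (b : κ → ℝ) (m : ℝ) (ha : ∀ i, m < a i) (hb : ∀ j, b j < m) :
    Tendsto (fun ε : ℝ => (Matrix.fromBlocks A (Matrix.of fun i j => ε ^ (m - b j) * B i j)
          (Matrix.of fun i j => ε ^ (a j - m) * C i j) D).det) (𝓝 0) (𝓝 (A.det * D.det)) := by
  have hcont : Continuous fun ε : ℝ =>
      (Matrix.fromBlocks A (Matrix.of fun i j => ε ^ (m - b j) * B i j)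
          (Matrix.of fun i j => ε ^ (a j - m) * C i j) D).det := by
    refine Continuous.matrix_det (Continuous.matrix_fromBlocks continuous_const ?_ ?_
      continuous_const)
    · exact continuous_matrix fun i j =>
        (Real.continuous_rpow_const (sub_pos.2 (hb j)).le).mul continuous_const
    · exact continuous_matrix fun i j =>
        (Real.continuous_rpow_const (sub_pos.2 (ha j)).le).mul continuous_const
  have hB : (Matrix.of fun i j => (0 : ℝ) ^ (m - b j) * B i j) = 0 := by
    ext i j
    simp [Real.zero_rpow (sub_pos.2 (hb j)).ne']
  have h0 := hcont.tendsto 0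
  rwa [hB, Matrix.det_fromBlocks_zero₁₂] at h0

theorem schur_eq_det_div (n : ℕ) (lam u : Fin n → ℝ) :
    schur n lam u =
      (Matrix.of fun i j : Fin n => u i ^ (lam j + n - (j.val + 1))).det / vandermondeProd n u :=
  rfl

theorem det_rpow_add_natCast (k h : ℕ) (lam z : Fin k → ℝ) (hz : ∀ i, 0 < z i) :
    (Matrix.of fun i j : Fin k => z i ^ (lam j + (k + h : ℕ) - (j.val + 1))).det =
      (∏ i, z i ^ h) * (Matrix.of fun i j : Fin k => z i ^ (lam j + k - (j.val + 1))).det := by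
  rw [← Matrix.det_mul_column]
  congr 1
  ext i j
  simp only [Matrix.of_apply]
  rw [← Real.rpow_natCast, ← Real.rpow_add (hz i)]
  congr 1
  push_cast
  ring

/-- **Splitting formula for generalized Schur functions.**
`lim_{ε→0⁺} S_η(z, εy) / ε^{|μ|} = S_λ(z) · S_μ(y)` where `η = (λ, μ)`. -/
theorem schur_splitting (k h : ℕ) (eta : Fin (k + h) → ℝ) (hpart : IsRealPartition (k + h) eta)
    (z : Fin k → ℝ) (hz : ∀ i, 0 < z i) (hzinj : Function.Injective z)
    (y : Fin h → ℝ) (hy : ∀ i, 0 < y i) (hyinj : Function.Injective y) :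
    Tendsto (fun ε : ℝ => schur (k + h) eta (Fin.append z fun i => ε * y i) / ε ^ (∑ i, eta (Fin.natAdd k i)))
      (nhdsWithin 0 {ε : ℝ | 0 < ε ∧ Function.Injective (Fin.append z fun i => ε * y i)})
      (nhds (schur k (fun i => eta (Fin.castAdd h i)) z * schur h (fun i => eta (Fin.natAdd k i)) y)) := by
  set lam : Fin k → ℝ := fun i => eta (Fin.castAdd h i) with hlam
  set mu : Fin h → ℝ := fun i => eta (Fin.natAdd k i) with hmu
  set a : Fin k → ℝ := fun j => lam j + (k + h : ℕ) - (j.val + 1) with ha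
  set b : Fin h → ℝ := fun j => mu j + h - (j.val + 1) with hb
  obtain ⟨m, hbm, hma⟩ : ∃ m, (∀ j, b j < m) ∧ ∀ i, m < a i := by
    obtain ⟨m, h1, h2⟩ := Order.exists_between_finsets (Finset.univ.image b) (Finset.univ.image a)
      (by
        simp only [Finset.mem_image, Finset.mem_univ, true_and, forall_exists_index,
          forall_apply_eq_imp_iff]
        intro j i
        have hij := hpart.1 (Fin.castAdd h i) (Fin.natAdd k j)
          (by simp only [Fin.lt_def, Fin.val_castAdd, Fin.val_natAdd]; omega)
        simp only [Fin.val_castAdd, Fin.val_natAdd] at hij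
        simp only [ha, hb, hlam, hmu]
        push_cast at hij ⊢
        linarith)
    exact ⟨m, fun j => h1 _ (by simp), fun i => h2 _ (by simp)⟩
  set A : Matrix (Fin k) (Fin k) ℝ := Matrix.of fun i j => z i ^ a j with hA
  set B : Matrix (Fin k) (Fin h) ℝ := Matrix.of fun i j => z i ^ b j with hB
  set C : Matrix (Fin h) (Fin k) ℝ := Matrix.of fun i j => y i ^ a j with hC
  set D : Matrix (Fin h) (Fin h) ℝ := Matrix.of fun i j => y i ^ b j with hD
  have hdet {ε : ℝ} (hε : 0 < ε) :
      (Matrix.of fun i j : Fin (k + h) => Fin.append z (fun i => ε * y i) i ^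
        (eta j + (k + h : ℕ) - (j.val + 1))).det =
      ε ^ (∑ j, b j) * (Matrix.fromBlocks A (Matrix.of fun i j => ε ^ (m - b j) * B i j)
          (Matrix.of fun i j => ε ^ (a j - m) * C i j) D).det := by
    have hexp (j : Fin h) :
        eta (Fin.natAdd k j) + (k + h : ℕ) - ((Fin.natAdd k j).val + 1) = b j := by
      simp only [hb, hmu, Fin.val_natAdd]
      push_cast
      ring
    rw [← det_fromBlocks_rpow A B C D a b m hε, ← Matrix.det_submatrix_equiv_self finSumFinEquiv]
    congr 1
    ext (i | i) (j | j)
    · simp [hA, ha, hlam]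
    · simp only [Matrix.submatrix_apply, finSumFinEquiv_apply_left, finSumFinEquiv_apply_right,
        Matrix.of_apply, hexp, Fin.append_left, Matrix.fromBlocks_apply₁₂, hB]
    · simp [hC, ha, hlam, Real.mul_rpow hε.le (hy i).le]
    · simp only [Matrix.submatrix_apply, finSumFinEquiv_apply_right,
        Matrix.of_apply, hexp, Fin.append_right, Matrix.fromBlocks_apply₂₂, hD,
        Real.mul_rpow hε.le (hy i).le]
  have hlim := tendsto_det_fromBlocks_rpow A B C D a b m hma hbm
  have hzpos : (∏ i, z i ^ h) ≠ 0 := Finset.prod_ne_zero_iff.2 fun i _ => (pow_pos (hz i) h).ne'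
  have hcross : Tendsto (fun ε : ℝ => ∏ j, ∏ i, (z i - ε * y j)) (𝓝 0) (𝓝 (∏ i, z i ^ h)) := by
    have hcont : Continuous fun ε : ℝ => ∏ j, ∏ i, (z i - ε * y j) := by fun_prop
    simpa [Finset.prod_pow] using hcont.tendsto 0
  have hG := ((hlim.div hcross hzpos).div_const (vandermondeProd k z * vandermondeProd h y)).mono_left
    (nhdsWithin_le_nhds (s := {ε : ℝ | 0 < ε ∧ Function.Injective (Fin.append z fun i => ε * y i)}))
  have hval : A.det * D.det / (∏ i, z i ^ h) / (vandermondeProd k z * vandermondeProd h y) =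
      schur k lam z * schur h mu y := by
    rw [schur_eq_det_div, schur_eq_det_div, hA, ha, det_rpow_add_natCast k h lam z hz, mul_assoc,
      mul_div_cancel_left₀ _ hzpos, mul_div_mul_comm]
  rw [hval] at hG
  refine hG.congr' (eventually_nhdsWithin_of_forall fun ε hε => ?_)
  have hsum : ∑ j, b j = (∑ j : Fin h, ((h : ℝ) - (j.val + 1))) + ∑ j, mu j := by
    rw [← Finset.sum_add_distrib]
    refine Finset.sum_congr rfl fun j _ => ?_
    simp only [hb]
    ring
  simp only [Pi.div_apply]
  rw [schur_eq_det_div, hdet hε.1, vandermondeProd_append, vandermondeProd_const_mul h ε hε.1, hsum,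
    Real.rpow_add hε.1]
  have h1 := (Real.rpow_pos_of_pos hε.1 (∑ j : Fin h, ((h : ℝ) - (j.val + 1)))).ne'
  have h2 := (Real.rpow_pos_of_pos hε.1 (∑ j, mu j)).ne'
  field_simp
end

section
/- Let 0 = r_0 < r_1 < ... < r_n be real numbers, let λ = (λ_1,...,λ_{n+1}) be the real partition associated with Λ_n = (r_0,...,r_n), defined by λ_j = r_n − r_{j−1} − (n − j + 1) for j = 1,...,n+1, and let λ^{(0)} = (λ_2,...,λ_{n+1}) be its bottom partition. Then for every t ∈ (0,1), the limit of the function (u_1,...,u_n) ↦ S_λ(1, u_1,...,u_n) / S_{λ^{(0)}}(u_1,...,u_n), as (u_1,...,u_n) tends to (t,...,t) within the set of tuples of pairwise distinct points of (0,1), exists and equals (−1)^n r_1 r_2 ⋯ r_n · [r_0, r_1,...,r_n]f_t / (1−t)^n; equivalently, [r_0,...,r_n]f_t = ((−1)^n/(r_1⋯r_n)) (1−t)^n times this limit. -/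
open Filter Topology

/-- Divided difference of `g` at the `n+1` points `x 0, ..., x n`. -/
noncomputable def divDiff (g : ℝ → ℝ) : (n : ℕ) → (Fin (n+1) → ℝ) → ℝ
  | 0, x => g (x 0)
  | n+1, x => (divDiff g n (fun i => x i.succ) - divDiff g n (fun i => x i.castSucc)) /
      (x (Fin.last (n+1)) - x 0)

open Polynomial in
/-- The divided difference is the top coefficient of the interpolating polynomial. -/
theorem divDiff_eq_coeff (g : ℝ → ℝ) (n : ℕ) (x : Fin (n + 1) → ℝ) (hx : Function.Injective x)
    (P : ℝ[X]) (hP : P.degree < (n + 1 : ℕ)) (hPx : ∀ i, P.eval (x i) = g (x i)) :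
    divDiff g n x = P.coeff n := by
  induction n generalizing P with
  | zero =>
    have hC : P = C (P.coeff 0) := eq_C_of_degree_le_zero (by
      rw [degree_le_iff_coeff_zero]
      intro m hm
      exact coeff_eq_zero_of_degree_lt (hP.trans_le (by
        have : 0 < m := by exact_mod_cast hm
        exact_mod_cast this)))
    have h0 := hPx 0
    rw [hC, eval_C] at h0
    simp [divDiff, h0]
  | succ n ih =>
    have hs : Function.Injective (fun i : Fin (n + 1) => x i.succ) :=
      hx.comp (Fin.succ_injective _)
    have hc : Function.Injective (fun i : Fin (n + 1) => x i.castSucc) :=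
      hx.comp (Fin.castSucc_injective _)
    set Q₁ : ℝ[X] := Lagrange.interpolate Finset.univ (fun i : Fin (n + 1) => x i.succ)
      (fun i => g (x i.succ)) with hQ₁
    set Q₀ : ℝ[X] := Lagrange.interpolate Finset.univ (fun i : Fin (n + 1) => x i.castSucc)
      (fun i => g (x i.castSucc)) with hQ₀
    have d₁ : Q₁.degree < (n + 1 : ℕ) := by
      simpa only [Finset.card_univ, Fintype.card_fin] using
        Lagrange.degree_interpolate_lt (s := Finset.univ)
          (fun i : Fin (n + 1) => g (x i.succ)) hs.injOn
    have d₀ : Q₀.degree < (n + 1 : ℕ) := by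
      simpa only [Finset.card_univ, Fintype.card_fin] using
        Lagrange.degree_interpolate_lt (s := Finset.univ)
          (fun i : Fin (n + 1) => g (x i.castSucc)) hc.injOn
    have e₁ : ∀ i : Fin (n + 1), Q₁.eval (x i.succ) = g (x i.succ) := fun i =>
      Lagrange.eval_interpolate_at_node (s := Finset.univ)
        (fun i : Fin (n + 1) => g (x i.succ)) hs.injOn (Finset.mem_univ i)
    have e₀ : ∀ i : Fin (n + 1), Q₀.eval (x i.castSucc) = g (x i.castSucc) := fun i =>
      Lagrange.eval_interpolate_at_node (s := Finset.univ)
        (fun i : Fin (n + 1) => g (x i.castSucc)) hc.injOn (Finset.mem_univ i)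
    have hne : x (Fin.last (n + 1)) - x 0 ≠ 0 :=
      sub_ne_zero.2 (hx.ne (by simp [Fin.ext_iff]))
    have hR : C (x (Fin.last (n + 1)) - x 0) * P =
        (X - C (x 0)) * Q₁ - (X - C (x (Fin.last (n + 1)))) * Q₀ := by
      refine eq_of_degrees_lt_of_eval_index_eq (v := x) Finset.univ hx.injOn ?_ ?_ ?_
      · rw [degree_C_mul hne]
        simpa using hP
      · have key : ∀ (a : ℝ) (Q : ℝ[X]), Q.degree < (n + 1 : ℕ) →
            ((X - C a) * Q).degree < ((n + 1 + 1 : ℕ) : WithBot ℕ) := by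
          intro a Q hQ
          rw [degree_mul, degree_X_sub_C]
          by_cases hQ0 : Q = 0
          · simp only [hQ0, degree_zero, WithBot.add_bot]
            exact WithBot.bot_lt_coe _
          · rw [degree_eq_natDegree hQ0] at hQ ⊢
            norm_cast at hQ ⊢
            omega
        rw [Finset.card_univ, Fintype.card_fin]
        exact (degree_sub_le _ _).trans_lt (max_lt (key _ _ d₁) (key _ _ d₀))
      · intro i _
        simp only [eval_mul, eval_sub, eval_X, eval_C, hPx]
        have h₁ : (x i - x 0) * Q₁.eval (x i) = (x i - x 0) * g (x i) := by
          refine Fin.cases (by simp) (fun j => by rw [e₁]) i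
        have h₀ : (x i - x (Fin.last (n + 1))) * Q₀.eval (x i) =
            (x i - x (Fin.last (n + 1))) * g (x i) := by
          refine Fin.lastCases (by simp) (fun j => by rw [e₀]) i
        rw [h₁, h₀]
        ring
    have hcoeff := congrArg (fun p => p.coeff (n + 1)) hR
    simp only [coeff_C_mul, coeff_sub, sub_mul, coeff_X_mul,
      coeff_eq_zero_of_degree_lt d₁, coeff_eq_zero_of_degree_lt d₀] at hcoeff
    rw [divDiff, ih _ hs Q₁ d₁ e₁, ih _ hc Q₀ d₀ e₀, div_eq_iff hne]
    linarith

/-- The explicit formula for the divided difference at distinct points. -/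
theorem divDiff_eq_sum (g : ℝ → ℝ) (n : ℕ) (x : Fin (n + 1) → ℝ) (hx : Function.Injective x) :
    divDiff g n x = ∑ i, g (x i) / ∏ j ∈ Finset.univ.erase i, (x i - x j) := by
  have hd := Lagrange.degree_interpolate_lt (s := Finset.univ) (fun i => g (x i)) hx.injOn
  have he := fun i => Lagrange.eval_interpolate_at_node (s := Finset.univ)
    (fun i => g (x i)) hx.injOn (Finset.mem_univ i)
  rw [divDiff_eq_coeff g n x hx _ (by simpa using hd) he]
  have := Lagrange.coeff_eq_sum hx.injOn hd
  simp only [he] at this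
  simpa using this

theorem sum_pow_div_prod_sub_eq_zero (n : ℕ) (x : Fin (n + 1) → ℝ) (hx : Function.Injective x)
    (k : ℕ) (hk : k < n) :
    ∑ i, x i ^ k / ∏ j ∈ Finset.univ.erase i, (x i - x j) = 0 := by
  have := Lagrange.coeff_eq_sum (s := Finset.univ) (P := (Polynomial.X ^ k : Polynomial ℝ))
    hx.injOn (by
      rw [Polynomial.degree_X_pow, Finset.card_univ, Fintype.card_fin]
      exact_mod_cast hk.trans (Nat.lt_succ_self n))
  simp only [Polynomial.eval_pow, Polynomial.eval_X] at this
  rw [← this]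
  simp [Polynomial.coeff_X_pow, hk.ne.symm]

/-- Iterated Rolle: a function with `k + 1` zeros in `[a, b]` has a zero of its `k`-th derivative
in `[a, b]`. -/
theorem exists_iterated_hasDerivAt_eq_zero (a b : ℝ) (k : ℕ) (f : ℕ → ℝ → ℝ)
    (hf : ∀ m x, HasDerivAt (f m) (f (m + 1) x) x) (x : ℕ → ℝ)
    (hx : ∀ i < k, x i < x (i + 1)) (hxI : ∀ i ≤ k, x i ∈ Set.Icc a b)
    (hz : ∀ i ≤ k, f 0 (x i) = 0) : ∃ ξ ∈ Set.Icc a b, f k ξ = 0 := by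
  induction k generalizing f x with
  | zero => exact ⟨x 0, hxI 0 le_rfl, hz 0 le_rfl⟩
  | succ k ih =>
    have h : ∀ i, ∃ y, i < k + 1 → y ∈ Set.Ioo (x i) (x (i + 1)) ∧ f 1 y = 0 := by
      intro i
      by_cases hi : i < k + 1
      · obtain ⟨c, hc, hc0⟩ := exists_hasDerivAt_eq_zero (f := f 0) (f' := f 1) (hx i hi)
          (fun z _ => (hf 0 z).continuousAt.continuousWithinAt)
          (by rw [hz i hi.le, hz (i + 1) hi]) (fun z _ => hf 0 z)
        exact ⟨c, fun _ => ⟨hc, hc0⟩⟩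
      · exact ⟨0, fun h => absurd h hi⟩
    choose y hy using h
    refine ih (fun m => f (m + 1)) (fun m => hf (m + 1)) y ?_ ?_ ?_
    · intro i hi
      exact (hy i (by omega)).1.2.trans (hy (i + 1) (by omega)).1.1
    · intro i hi
      have := (hy i (by omega)).1
      exact ⟨(hxI i (by omega)).1.trans this.1.le, this.2.le.trans (hxI (i + 1) (by omega)).2⟩
    · intro i hi
      exact (hy i (by omega)).2

theorem exists_dist_le_hasDerivAt_eq_zero {n : ℕ} (f : ℕ → ℝ → ℝ)
    (hf : ∀ m x, HasDerivAt (f m) (f (m + 1) x) x) (s : Fin n → ℝ) (hs : Function.Injective s)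
    (hz : ∀ i, f 0 (s i) = 0) (τ : ℝ) :
    ∃ ξ : Fin n → ℝ, dist ξ (Function.const _ τ) ≤ dist s (Function.const _ τ) ∧
      ∀ k : Fin n, f k (ξ k) = 0 := by
  set δ := dist s (Function.const _ τ) with hδ
  have hcard : (Finset.univ.image s).card = n := by
    rw [Finset.card_image_of_injective _ hs]; simp
  let e := (Finset.univ.image s).orderEmbOfFin hcard
  have he : ∀ i, ∃ j, s j = e i := fun i => by
    obtain ⟨j, -, hj⟩ := Finset.mem_image.1 (Finset.orderEmbOfFin_mem (Finset.univ.image s) hcard i)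
    exact ⟨j, hj⟩
  have hI : ∀ i, e i ∈ Set.Icc (τ - δ) (τ + δ) := by
    intro i
    obtain ⟨j, hj⟩ := he i
    rw [← hj, ← Real.closedBall_eq_Icc, Metric.mem_closedBall]
    exact dist_le_pi_dist s (Function.const _ τ) j
  have h : ∀ k : Fin n, ∃ ξ ∈ Set.Icc (τ - δ) (τ + δ), f k ξ = 0 := by
    intro k
    refine exists_iterated_hasDerivAt_eq_zero _ _ k f hf
      (fun i => if h : i < n then e ⟨i, h⟩ else 0) ?_ ?_ ?_
    · intro i hi
      have h1 : i < n := hi.trans k.2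
      have h2 : i + 1 < n := lt_of_le_of_lt hi k.2
      simp only [h1, h2, dif_pos]
      exact e.strictMono (by simp [Fin.lt_def])
    · intro i hi
      have h1 : i < n := lt_of_le_of_lt hi k.2
      simp only [h1, dif_pos]
      exact hI _
    · intro i hi
      have h1 : i < n := lt_of_le_of_lt hi k.2
      simp only [h1, dif_pos]
      obtain ⟨j, hj⟩ := he ⟨i, h1⟩
      rw [← hj, hz]
  choose ξ hξ hξ0 using h
  refine ⟨ξ, (dist_pi_le_iff dist_nonneg).2 fun i => ?_, hξ0⟩
  have := hξ i
  rwa [← Real.closedBall_eq_Icc, Metric.mem_closedBall] at this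

/-- The Wronskian-type matrix of the functions `x ↦ exp (-ρ j * x)`, with the row of `k`-th
derivatives evaluated at the point `ξ k`. -/
noncomputable def expMatrix {n : ℕ} (ρ ξ : Fin n → ℝ) : Matrix (Fin n) (Fin n) ℝ :=
  Matrix.of fun k j => (-ρ j) ^ (k : ℕ) * Real.exp (-ρ j * ξ k)

theorem continuous_expMatrix {n : ℕ} (ρ : Fin n → ℝ) : Continuous (expMatrix ρ) := by
  refine continuous_matrix fun k j => ?_
  simp only [expMatrix, Matrix.of_apply]
  fun_prop

theorem det_expMatrix_const_ne_zero {n : ℕ} (ρ : Fin n → ℝ) (hρ : Function.Injective ρ) (τ : ℝ) :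
    (expMatrix ρ (Function.const _ τ)).det ≠ 0 := by
  have : expMatrix ρ (Function.const _ τ) =
      (Matrix.vandermonde fun j => -ρ j).transpose *
        Matrix.diagonal fun j => Real.exp (-ρ j * τ) := by
    ext k j
    simp [expMatrix, Matrix.vandermonde_apply, Matrix.mul_diagonal]
  rw [this, Matrix.det_mul, Matrix.det_transpose, Matrix.det_diagonal]
  refine mul_ne_zero (Matrix.det_vandermonde_ne_zero_iff.2 fun i j h => hρ (neg_injective h))
    (Finset.prod_ne_zero_iff.2 fun j _ => Real.exp_ne_zero _)

/-- Rolle's theorem for a constant plus an exponential sum vanishing at the points `s i`. -/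
theorem exists_expMatrix_mulVec {n : ℕ} (ρ b : Fin n → ℝ) (b₀ : ℝ) (s : Fin n → ℝ)
    (hs : Function.Injective s) (hz : ∀ i, ∑ j, b j * Real.exp (-ρ j * s i) = b₀) (τ : ℝ) :
    ∃ ξ : Fin n → ℝ, dist ξ (Function.const _ τ) ≤ dist s (Function.const _ τ) ∧
      (expMatrix ρ ξ).mulVec b = fun k : Fin n => b₀ * (0 : ℝ) ^ (k : ℕ) := by
  obtain ⟨ξ, hξ, h⟩ := exists_dist_le_hasDerivAt_eq_zero
    (fun k x => ∑ j, b j * ((-ρ j) ^ k * Real.exp (-ρ j * x)) - b₀ * 0 ^ k) (by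
      intro m x
      have h1 : ∀ j ∈ (Finset.univ : Finset (Fin n)),
          HasDerivAt (fun x => b j * ((-ρ j) ^ m * Real.exp (-ρ j * x)))
          (b j * ((-ρ j) ^ (m + 1) * Real.exp (-ρ j * x))) x := by
        intro j _
        have := ((((hasDerivAt_id x).const_mul (-ρ j)).exp).const_mul ((-ρ j) ^ m)).const_mul (b j)
        exact this.congr_deriv (by simp only [id]; ring)
      exact ((HasDerivAt.fun_sum h1).sub_const (b₀ * 0 ^ m)).congr_deriv (by simp)) s hs
    (fun i => sub_eq_zero.2 (by simpa using hz i)) τ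
  refine ⟨ξ, hξ, funext fun k => ?_⟩
  rw [← sub_eq_zero.1 (h k)]
  simp only [Matrix.mulVec, dotProduct, expMatrix, Matrix.of_apply]
  exact Finset.sum_congr rfl fun j _ => mul_comm _ _

/-- The value at `0` of `1 - ∑ j, c j * exp (-ρ j * x)`, where the coefficients `c` are such that
its `k`-th derivative vanishes at `ξ k` for every `k`. -/
noncomputable def expValue {n : ℕ} (ρ ξ : Fin n → ℝ) : ℝ :=
  1 - ∑ j, ((expMatrix ρ ξ)⁻¹.mulVec fun k : Fin n => (0 : ℝ) ^ (k : ℕ)) j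

theorem expValue_eq {n : ℕ} {ρ ξ c : Fin n → ℝ} (hdet : (expMatrix ρ ξ).det ≠ 0)
    (hc : (expMatrix ρ ξ).mulVec c = fun k : Fin n => (0 : ℝ) ^ (k : ℕ)) : expValue ρ ξ = 1 - ∑ j, c j := by
  rw [expValue, ← hc, Matrix.mulVec_mulVec, Matrix.nonsing_inv_mul _ (isUnit_iff_ne_zero.2 hdet),
    Matrix.one_mulVec]

theorem continuousAt_expValue {n : ℕ} {ρ ξ : Fin n → ℝ} (hdet : (expMatrix ρ ξ).det ≠ 0) :
    ContinuousAt (expValue ρ) ξ := by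
  have hA := continuous_expMatrix ρ
  have hinv : ContinuousAt (fun ξ => (expMatrix ρ ξ)⁻¹) ξ := by
    simp only [Matrix.inv_def, Ring.inverse_eq_inv']
    exact (hA.matrix_det.continuousAt.inv₀ hdet).smul hA.matrix_adjugate.continuousAt
  unfold expValue Matrix.mulVec dotProduct
  refine continuousAt_const.sub (tendsto_finsetSum _ fun j _ => tendsto_finsetSum _ fun k _ => ?_)
  exact (((continuous_apply_apply j k).continuousAt.comp hinv :)).mul continuousAt_const

/-- At a constant tuple `expValue` is a multiple of a divided difference. -/
theorem expValue_const (n : ℕ) (r : ℕ → ℝ) (hr0 : r 0 = 0)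
    (hr : Function.Injective fun i : Fin (n + 1) => r i) (t : ℝ) (ht : 0 < t) :
    expValue (fun j : Fin n => r (j + 1)) (Function.const _ (Real.log t)) =
      (-1) ^ n * (∏ i ∈ Finset.Icc 1 n, r i) * divDiff (fun x => t ^ x) n fun i => r i := by
  have hinj : Function.Injective fun j : Fin n => r (j + 1) := by
    simpa using! hr.comp (Fin.succ_injective n)
  set w : Fin (n + 1) → ℝ := fun i => ∏ j ∈ Finset.univ.erase i, (r i - r j) with hw
  have hw0 : w 0 = (-1) ^ n * ∏ i ∈ Finset.Icc 1 n, r i := by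
    have h1 : (Finset.univ.erase (0 : Fin (n + 1))) = Finset.univ.map (Fin.succEmb n) := by
      ext i
      refine Fin.cases (by simp) (fun i => by simp) i
    have h2 : ∏ i ∈ Finset.Icc 1 n, r i = ∏ j : Fin n, r (j + 1) := by
      rw [Fin.prod_univ_eq_prod_range (fun j => r (j + 1)) n, Finset.range_eq_Ico,
        Finset.prod_Ico_add' r 0 n 1]
      rfl
    simp only [hw, h1, Finset.prod_map, Fin.val_zero, hr0, zero_sub, Fin.coe_succEmb, Fin.val_succ,
      h2, Finset.prod_neg, Finset.card_map, Finset.card_univ, Fintype.card_fin]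
  have hwne : w 0 ≠ 0 := Finset.prod_ne_zero_iff.2 fun j hj =>
    sub_ne_zero.2 (hr.ne (Finset.ne_of_mem_erase hj).symm)
  have hdet := det_expMatrix_const_ne_zero _ hinj (Real.log t)
  rw [expValue_eq hdet (c := fun j => -(w 0 * (t ^ r (j + 1) / w j.succ)))]
  · rw [divDiff_eq_sum _ _ _ hr, Fin.sum_univ_succ, ← hw0]
    simp only [Fin.val_zero, hr0, Real.rpow_zero, Fin.val_succ, mul_add, Finset.mul_sum,
      Finset.sum_neg_distrib, sub_neg_eq_add]
    congr 1
    have : (∏ j ∈ Finset.univ.erase (0 : Fin (n + 1)), (0 - r j)) = w 0 := by simp [hw, hr0]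
    rw [this]
    field_simp
  · funext k
    have hsum : ∑ i : Fin (n + 1), r i ^ (k : ℕ) / w i = 0 :=
      sum_pow_div_prod_sub_eq_zero n _ hr k k.2
    rw [Fin.sum_univ_succ] at hsum
    simp only [Fin.val_zero, hr0, Fin.val_succ] at hsum
    have h1 : ∀ j : Fin n, (-r (j + 1)) ^ (k : ℕ) * Real.exp (-r (j + 1) * Real.log t) *
        -(w 0 * (t ^ r (j + 1) / w j.succ)) =
        -(w 0 * (-1) ^ (k : ℕ)) * (r (j + 1) ^ (k : ℕ) / w j.succ) := by
      intro j
      have he : Real.exp (-r (j + 1) * Real.log t) * t ^ r (j + 1) = 1 := by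
        rw [Real.rpow_def_of_pos ht, ← Real.exp_add]
        simp [mul_comm]
      rw [neg_pow]
      linear_combination (-((-1) ^ (k : ℕ) * r (j + 1) ^ (k : ℕ) * w 0 / w j.succ)) * he
    simp only [Matrix.mulVec, dotProduct, expMatrix, Matrix.of_apply, Function.const_apply, h1]
    rw [← Finset.mul_sum]
    have h2 : ∑ j : Fin n, r (j + 1) ^ (k : ℕ) / w j.succ = -(0 ^ (k : ℕ) / w 0) := by
      linear_combination hsum
    rw [h2]
    rcases Nat.eq_zero_or_pos (k : ℕ) with hk | hk
    · rw [hk]; field_simp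
    · rw [zero_pow hk.ne']; simp

/-- The quotient of Schur functions as the value at `1` of a generalized polynomial that vanishes
at the points `u i`. -/
theorem schur_quotient_eq (n : ℕ) (r : ℕ → ℝ) (hr0 : r 0 = 0) (u c : Fin n → ℝ)
    (huinj : Function.Injective u)
    (hD : (Matrix.of fun i j : Fin n => u i ^ (r n - r (j + 1))).det ≠ 0)
    (hc : ∀ i, ∑ j, c j * u i ^ (r n - r (j + 1)) = u i ^ r n) :
    schur (n + 1) (fun i : Fin (n + 1) => r n - r i.val - ((n : ℝ) - i.val)) (Fin.cons 1 u) /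
      schur n (fun i : Fin n => r n - r (i.val + 1) - ((n : ℝ) - (i.val + 1))) u =
    (1 - ∑ j, c j) / ∏ i, (1 - u i) := by
  set V := ∏ j : Fin n, ∏ i ∈ Finset.univ.filter (· < j), (u i - u j) with hV
  have hV0 : V ≠ 0 := Finset.prod_ne_zero_iff.2 fun j _ => Finset.prod_ne_zero_iff.2 fun i hi =>
    sub_ne_zero.2 (huinj.ne (Finset.mem_filter.1 hi).2.ne)
  have hV1 : ∏ j : Fin (n + 1), ∏ i ∈ Finset.univ.filter (· < j),
      ((Fin.cons 1 u : Fin (n + 1) → ℝ) i - (Fin.cons 1 u : Fin (n + 1) → ℝ) j) =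
      (∏ i, (1 - u i)) * V := by
    simp only [Finset.prod_filter]
    rw [Fin.prod_univ_succ]
    simp [Fin.prod_univ_succ, Finset.prod_mul_distrib, hV, Finset.prod_filter]
  set M : Matrix (Fin (n + 1)) (Fin (n + 1)) ℝ :=
    Matrix.of fun i j => (Fin.cons 1 u : Fin (n + 1) → ℝ) i ^ (r n - r j) with hM
  have hMdet : M.det = (1 - ∑ j, c j) *
      (Matrix.of fun i j : Fin n => u i ^ (r n - r (j + 1))).det := by
    have h := M.det_updateCol_sum 0 (Fin.cons 1 fun j => -c j)
    rw [Fin.cons_zero, one_smul] at h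
    rw [← h, Matrix.det_succ_column_zero, Fin.sum_univ_succ, Finset.sum_eq_zero]
    · have hsub : ((M.updateCol 0 fun k => ∑ i : Fin (n + 1),
          (Fin.cons 1 (fun j => -c j) : Fin (n + 1) → ℝ) i • M k i).submatrix
            (Fin.succAbove 0) Fin.succ) =
          Matrix.of fun i j : Fin n => u i ^ (r n - r (j + 1)) := by
        ext i j
        simp [hM]
      rw [hsub]
      simp [Fin.sum_univ_succ, hM, sub_eq_add_neg]
    · intro i _
      have := hc i
      simp [Fin.sum_univ_succ, hM, hr0, this]
  have e1 : ∀ j : Fin (n + 1),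
      r n - r j - ((n : ℝ) - j) + ((n + 1 : ℕ) : ℝ) - (j + 1) = r n - r j := by
    intro j; push_cast; ring
  have e2 : ∀ j : Fin n,
      r n - r (j + 1) - ((n : ℝ) - (j + 1)) + (n : ℝ) - (j + 1) = r n - r (j + 1) := by
    intro j; ring
  simp only [schur, e1, e2]
  rw [hV1, ← hV, ← hM, hMdet]
  field_simp

/-- Near the diagonal, the quotient of Schur functions is `expValue` at a nearby tuple. -/
theorem exists_schur_quotient_eq_expValue (n : ℕ) (r : ℕ → ℝ) (hr0 : r 0 = 0) (τ : ℝ)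
    (u : Fin n → ℝ) (hu : ∀ i, 0 < u i) (huinj : Function.Injective u)
    (hdet : ∀ ξ : Fin n → ℝ,
      dist ξ (Function.const _ τ) ≤ dist (fun i => Real.log (u i)) (Function.const _ τ) →
      (expMatrix (fun j : Fin n => r (j + 1)) ξ).det ≠ 0) :
    ∃ ξ : Fin n → ℝ,
      dist ξ (Function.const _ τ) ≤ dist (fun i => Real.log (u i)) (Function.const _ τ) ∧
      schur (n + 1) (fun i : Fin (n + 1) => r n - r i.val - ((n : ℝ) - i.val)) (Fin.cons 1 u) /
        schur n (fun i : Fin n => r n - r (i.val + 1) - ((n : ℝ) - (i.val + 1))) u =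
      expValue (fun j : Fin n => r (j + 1)) ξ / ∏ i, (1 - u i) := by
  have hs : Function.Injective fun i => Real.log (u i) := fun i j h =>
    huinj (Real.log_injOn_pos (hu i) (hu j) h)
  have hpow : ∀ i (j : Fin n), u i ^ (r n - r (j + 1)) =
      u i ^ r n * Real.exp (-r (j + 1) * Real.log (u i)) := by
    intro i j
    rw [Real.rpow_def_of_pos (hu i), Real.rpow_def_of_pos (hu i), ← Real.exp_add]
    ring_nf
  have hfac : ∀ (c : Fin n → ℝ) i, ∑ j, c j * u i ^ (r n - r (j + 1)) =
      u i ^ r n * ∑ j, c j * Real.exp (-r (j + 1) * Real.log (u i)) := by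
    intro c i
    rw [Finset.mul_sum]
    exact Finset.sum_congr rfl fun j _ => by rw [hpow]; ring
  have hupos : ∀ i, u i ^ r n ≠ 0 := fun i => (Real.rpow_pos_of_pos (hu i) _).ne'
  set D : Matrix (Fin n) (Fin n) ℝ := Matrix.of fun i j => u i ^ (r n - r (j + 1)) with hD
  have hmul : ∀ c i, D.mulVec c i = ∑ j, c j * u i ^ (r n - r (j + 1)) := fun c i => by
    simp only [Matrix.mulVec, dotProduct, hD, Matrix.of_apply, mul_comm]
  have hDdet : D.det ≠ 0 := by
    intro h0
    obtain ⟨b, hb, hb0⟩ := Matrix.exists_mulVec_eq_zero_iff.2 h0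
    obtain ⟨ξ, hξ, h⟩ := exists_expMatrix_mulVec (fun j : Fin n => r (j + 1)) b 0 _ hs (by
      intro i
      have := congrFun hb0 i
      rw [hmul, hfac] at this
      exact (mul_eq_zero.1 this).resolve_left (hupos i)) τ
    refine hdet ξ hξ (Matrix.exists_mulVec_eq_zero_iff.1 ⟨b, hb, ?_⟩)
    rw [h]
    funext k
    simp
  set c := D⁻¹.mulVec fun i => u i ^ r n with hc
  have hDc : D.mulVec c = fun i => u i ^ r n := by
    rw [hc, Matrix.mulVec_mulVec, Matrix.mul_nonsing_inv _ (isUnit_iff_ne_zero.2 hDdet),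
      Matrix.one_mulVec]
  have hci : ∀ i, ∑ j, c j * u i ^ (r n - r (j + 1)) = u i ^ r n := fun i => by
    rw [← hmul, hDc]
  obtain ⟨ξ, hξ, h⟩ := exists_expMatrix_mulVec (fun j : Fin n => r (j + 1)) c 1 _ hs (by
    intro i
    have := hci i
    rw [hfac] at this
    exact mul_left_cancel₀ (hupos i) (this.trans (mul_one _).symm)) τ
  refine ⟨ξ, hξ, ?_⟩
  rw [schur_quotient_eq n r hr0 u c huinj hDdet hci, expValue_eq (hdet ξ hξ) (by simpa using h)]

/-- The quotient `S_λ(1, u_1, ..., u_n) / S_{λ⁽⁰⁾}(u_1, ..., u_n)` tends, as the points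
`u_i` tend to `t` while staying pairwise distinct in `(0,1)`, to
`(-1)^n r_1 ⋯ r_n [r_0, ..., r_n]f_t / (1-t)^n`, where `λ` is the real partition associated
with `Λ_n` (`λ_j = r_n - r_{j-1} - (n - j + 1)`) and `λ⁽⁰⁾` its bottom partition. -/
theorem schur_quotient_divided_difference (n : ℕ) (r : ℕ → ℝ) (hr0 : r 0 = 0)
    (hmono : ∀ i, i < n → r i < r (i + 1)) (t : ℝ) (ht : t ∈ Set.Ioo (0:ℝ) 1) :
    Tendsto
      (fun u : Fin n → ℝ =>
        schur (n + 1) (fun i : Fin (n + 1) => r n - r i.val - ((n : ℝ) - i.val)) (Fin.cons 1 u) /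
          schur n (fun i : Fin n => r n - r (i.val + 1) - ((n : ℝ) - (i.val + 1))) u)
      (nhdsWithin (Function.const (Fin n) t)
        {u : Fin n → ℝ | (∀ i, u i ∈ Set.Ioo (0:ℝ) 1) ∧ Function.Injective u})
      (nhds ((-1 : ℝ) ^ n * (∏ i ∈ Finset.Icc 1 n, r i) *
        divDiff (fun x => t ^ x) n (fun i => r i.val) / (1 - t) ^ n)) := by
  have hmono' : StrictMono fun i : Fin (n + 1) => r i :=
    Fin.strictMono_iff_lt_succ.2 fun i => by simpa using hmono i i.2
  have hr := hmono'.injective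
  have hinj : Function.Injective fun j : Fin n => r (j + 1) := by
    simpa using! hr.comp (Fin.succ_injective n)
  set τ := Real.log t
  set F := nhdsWithin (Function.const (Fin n) t)
    {u : Fin n → ℝ | (∀ i, u i ∈ Set.Ioo (0:ℝ) 1) ∧ Function.Injective u}
  have hF : Tendsto (fun u : Fin n → ℝ => u) F (𝓝 (Function.const _ t)) :=
    tendsto_id.mono_left nhdsWithin_le_nhds
  have hFi : ∀ i, Tendsto (fun u : Fin n → ℝ => u i) F (𝓝 t) := fun i => (tendsto_pi_nhds.1 hF) i
  have hdet := det_expMatrix_const_ne_zero _ hinj τ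
  have hlog : Tendsto (fun u : Fin n → ℝ => fun i => Real.log (u i)) F
      (𝓝 (Function.const _ τ)) :=
    tendsto_pi_nhds.2 fun i => (hFi i).log ht.1.ne'
  have hdist := tendsto_iff_dist_tendsto_zero.1 hlog
  obtain ⟨δ, hδ, hball⟩ := Metric.eventually_nhds_iff.1
    ((continuous_expMatrix fun j : Fin n => r (j + 1)).matrix_det.continuousAt.eventually_ne hdet)
  have hex : ∀ᶠ u in F, ∃ ξ : Fin n → ℝ,
      dist ξ (Function.const _ τ) ≤ dist (fun i => Real.log (u i)) (Function.const _ τ) ∧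
      schur (n + 1) (fun i : Fin (n + 1) => r n - r i.val - ((n : ℝ) - i.val)) (Fin.cons 1 u) /
        schur n (fun i : Fin n => r n - r (i.val + 1) - ((n : ℝ) - (i.val + 1))) u =
      expValue (fun j : Fin n => r (j + 1)) ξ / ∏ i, (1 - u i) := by
    filter_upwards [self_mem_nhdsWithin, hdist.eventually_lt_const hδ] with u hu hud
    exact exists_schur_quotient_eq_expValue n r hr0 τ u (fun i => (hu.1 i).1) hu.2
      fun ξ hξ => hball (hξ.trans_lt hud)
  obtain ⟨Ξ, hΞ⟩ := skolem.1 hex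
  have hΞlim : Tendsto Ξ F (𝓝 (Function.const _ τ)) :=
    tendsto_iff_dist_tendsto_zero.2 (squeeze_zero' (Eventually.of_forall fun _ => dist_nonneg)
      (hΞ.mono fun u hu => hu.1) hdist)
  have hprod : Tendsto (fun u : Fin n → ℝ => ∏ i, (1 - u i)) F (𝓝 ((1 - t) ^ n)) := by
    simpa using tendsto_finsetProd Finset.univ fun i _ => (hFi i).const_sub 1
  rw [← expValue_const n r hr0 hr t ht.1]
  refine Tendsto.congr' (hΞ.mono fun u hu => hu.2.symm) ?_
  exact ((continuousAt_expValue hdet).tendsto.comp hΞlim).div hprod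
    (pow_ne_zero _ (sub_pos.2 ht.2).ne')
end

section
/- (Principal specialization of generalized Schur functions) Let λ = (λ_1,...,λ_n) be a real partition, i.e. λ_1 > λ_2 − 1 > λ_3 − 2 > ... > λ_n − (n−1) > −n. Then lim_{q→1} S_λ(1, q, q²,...,q^{n−1}) = ∏_{1≤j<k≤n} (λ_j − λ_k − j + k) / ∏_{j=1}^n (j−1)!, where the limit is taken as q → 1 with q > 0, q ≠ 1 (so that the arguments 1, q,...,q^{n−1} are pairwise distinct). -/
open Filter Topology

/-- The difference quotient at `1` of `q ↦ q ^ a - q ^ b` tends to `a - b`. -/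
lemma tendsto_rpow_sub_rpow_div_sub_one (a b : ℝ) :
    Tendsto (fun q : ℝ => (q ^ a - q ^ b) / (q - 1)) (𝓝[≠] 1) (𝓝 (a - b)) := by
  have h : HasDerivAt (fun q : ℝ => q ^ a - q ^ b) (a - b) 1 := by
    have hpow (r : ℝ) : HasDerivAt (fun q : ℝ => q ^ r) r 1 := by
      simpa using Real.hasDerivAt_rpow_const (x := 1) (p := r) (Or.inl one_ne_zero)
    exact (hpow a).sub (hpow b)
  refine h.tendsto_slope.congr fun q => ?_
  simp [slope_def_field]

lemma tendsto_rpow_sub_rpow_div (a b c d : ℝ) (hcd : c ≠ d) :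
    Tendsto (fun q : ℝ => (q ^ a - q ^ b) / (q ^ c - q ^ d)) (𝓝[≠] 1)
      (𝓝 ((a - b) / (c - d))) := by
  refine ((tendsto_rpow_sub_rpow_div_sub_one a b).div
    (tendsto_rpow_sub_rpow_div_sub_one c d) (sub_ne_zero.2 hcd)).congr' ?_
  filter_upwards [self_mem_nhdsWithin] with q hq
  exact div_div_div_cancel_right₀ (sub_ne_zero.2 hq) _ _

lemma prod_filter_lt_sub_eq_prod_factorial (n : ℕ) :
    ∏ j : Fin n, ∏ k ∈ Finset.univ.filter (j < ·), ((k : ℕ) - (j : ℕ) : ℝ) =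
      ∏ j ∈ Finset.range n, (Nat.factorial j : ℝ) := by
  cases n with
  | zero => simp
  | succ n =>
    have h := Matrix.det_vandermonde_id_eq_superFactorial (R := ℝ) n
    rw [Matrix.det_vandermonde] at h
    simp only [Finset.filter_lt_eq_Ioi]
    rw [h, ← Nat.prod_range_factorial_succ, Finset.prod_range_succ']
    simp only [Nat.factorial_zero, Nat.cast_one, mul_one, Nat.cast_prod]

/-- On geometric progressions the generalized Schur function factors. -/
lemma schur_geometric (n : ℕ) (lam : Fin n → ℝ) {q : ℝ} (hq : 0 < q) :
    schur n lam (fun i : Fin n => q ^ (i : ℕ)) =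
      ∏ j : Fin n, ∏ k ∈ Finset.univ.filter (j < ·),
        (q ^ (lam k + n - (k.val + 1)) - q ^ (lam j + n - (j.val + 1))) /
          (q ^ (j.val : ℝ) - q ^ (k.val : ℝ)) := by
  have hM : (Matrix.of fun i j : Fin n => (q ^ (i : ℕ)) ^ (lam j + n - (j.val + 1))) =
      (Matrix.vandermonde fun j : Fin n => q ^ (lam j + n - (j.val + 1))).transpose := by
    ext i j
    simp [Matrix.vandermonde_apply, Real.rpow_pow_comm hq.le]
  have hD : ∏ j : Fin n, ∏ i ∈ Finset.univ.filter (· < j), (q ^ (i : ℕ) - q ^ (j : ℕ)) =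
      ∏ j : Fin n, ∏ k ∈ Finset.univ.filter (j < ·), (q ^ (j : ℕ) - q ^ (k : ℕ)) :=
    Finset.prod_comm' (by simp)
  rw [schur, hM, Matrix.det_transpose, Matrix.det_vandermonde, hD]
  simp only [Finset.filter_lt_eq_Ioi, Real.rpow_natCast, Finset.prod_div_distrib]

/-- **Principal specialization of generalized Schur functions.** For a real partition `λ`,
`lim_{q→1} S_λ(1, q, q², ..., q^{n-1}) = ∏_{1 ≤ j < k ≤ n} (λ_j - λ_k - j + k) / ∏_{j=1}^n (j-1)!`,
the limit being over `q > 0`, `q ≠ 1`. -/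
theorem schur_principal_specialization (n : ℕ) (lam : Fin n → ℝ)
    (hpart : IsRealPartition n lam) :
    Tendsto (fun q : ℝ => schur n lam fun i : Fin n => q ^ (i : ℕ))
      (nhdsWithin 1 ({q : ℝ | 0 < q} \ {1}))
      (nhds ((∏ j : Fin n, ∏ k ∈ Finset.univ.filter (j < ·), (lam j - lam k - j.val + k.val)) /
        ∏ j ∈ Finset.range n, (Nat.factorial j : ℝ))) := by
  rw [← prod_filter_lt_sub_eq_prod_factorial, ← Finset.prod_div_distrib]
  simp only [← Finset.prod_div_distrib]
  have hev : (fun q : ℝ => schur n lam fun i : Fin n => q ^ (i : ℕ))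
      =ᶠ[𝓝[{q : ℝ | 0 < q} \ {1}] 1] _ :=
    eventually_nhdsWithin_of_forall fun q hq => schur_geometric n lam hq.1
  refine Tendsto.congr' hev.symm ?_
  refine tendsto_finsetProd _ fun j _ => tendsto_finsetProd _ fun k hk => ?_
  have hjk : (j.val : ℝ) ≠ k.val := by
    have : j < k := by simpa using hk
    exact Nat.cast_injective.ne (Fin.val_injective.ne this.ne)
  have h := (tendsto_rpow_sub_rpow_div (lam k + n - (k.val + 1)) (lam j + n - (j.val + 1))
    j.val k.val hjk).mono_left (nhdsWithin_mono 1
      (s := {q : ℝ | 0 < q} \ {1}) fun q hq => hq.2)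
  convert h using 2
  rw [← neg_div_neg_eq]
  congr 1 <;> ring
end
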